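/- For every ε > 0 there exists a constant c_ε ∈ (0,∞) such that, as x → ∞, the sum ∑_{p ≤ x} f_ε(p) over odd primes p ≤ x is asymptotic to c_ε · x / log x; that is, (log x / x) · ∑_{p ≤ x} f_ε(p) → c_ε. -/

import Mathlib

open Finset Filter

noncomputable section

/-- `S ℓ p = ∑_{n ≤ ℓ} (n/p)`, the quadratic character sum (Legendre symbol for odd prime `p`). -/
def S (ℓ p : ℕ) : ℤ := ∑ n ∈ Finset.Icc 1 ℓ, jacobiSym (n : ℤ) p

/-- the first-passage time `f_ε(p) = min {ℓ ≥ 1 : S_ℓ(p) < ε ℓ}`. -/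
def fpt (ε : ℝ) (p : ℕ) : ℕ := sInf {ℓ : ℕ | 1 ≤ ℓ ∧ ((S ℓ p : ℝ)) < ε * ℓ}

/-- the odd primes up to a real number `x`. -/
def oddPrimesUpTo (x : ℝ) : Finset ℕ :=
  (Finset.range (⌊x⌋₊ + 1)).filter (fun p => p.Prime ∧ p ≠ 2)

/-- `π_odd(x)`, the number of odd primes up to `x`. -/
def piOdd (x : ℝ) : ℕ := (oddPrimesUpTo x).card

/-- `P_ℓ(x)`, the density of odd primes `p ≤ x` with `S_ℓ(p) ≥ ε ℓ`. -/
def Pdens (ε : ℝ) (ℓ : ℕ) (x : ℝ) : ℝ :=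
  (((oddPrimesUpTo x).filter (fun p => ε * ℓ ≤ (S ℓ p : ℝ))).card : ℝ) / (piOdd x : ℝ)

/-- `a_m(x) = N_m(x)/π_odd(x)`, the proportion of odd primes `p ≤ x` with `f_ε(p) > m`. -/
def aCoef (ε : ℝ) (m : ℕ) (x : ℝ) : ℝ :=
  (((oddPrimesUpTo x).filter (fun p => m < fpt ε p)).card : ℝ) / (piOdd x : ℝ)

/-- `c_u(ℓ)`, the number of triples `(a,b,c) ∈ {1,…,ℓ}³` with `abc = u`. -/
def cCoef (ℓ u : ℕ) : ℕ :=
  ((Finset.Icc 1 ℓ ×ˢ Finset.Icc 1 ℓ ×ˢ Finset.Icc 1 ℓ).filter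
    (fun t => t.1 * t.2.1 * t.2.2 = u)).card

/-- `C_3(ℓ) = ∑_{u,v ≤ ℓ³, uv = □} c_u(ℓ) c_v(ℓ)`. -/
def C3 (ℓ : ℕ) : ℕ :=
  ∑ q ∈ (Finset.Icc 1 (ℓ ^ 3) ×ˢ Finset.Icc 1 (ℓ ^ 3)).filter (fun q => IsSquare (q.1 * q.2)),
    cCoef ℓ q.1 * cCoef ℓ q.2

namespace FPT
open MeasureTheory

def fej (w : ℝ) : ℝ := ∫ v in (0:ℝ)..1, (1 - v) * Real.cos (v * w)

lemma fej_eq {w : ℝ} (hw : w ≠ 0) : fej w = (1 - Real.cos w) / w ^ 2 := by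
  unfold fej
  have h : ∀ v ∈ Set.uIcc (0:ℝ) 1, HasDerivAt
      (fun v => (1 - v) * (Real.sin (v * w) / w) - Real.cos (v * w) / w ^ 2)
      ((1 - v) * Real.cos (v * w)) v := by
    intro v _
    have h1 : HasDerivAt (fun v : ℝ => v * w) w v := by simpa using (hasDerivAt_id v).mul_const w
    have h2 := h1.sin.div_const w
    have h3 := h1.cos.div_const (w ^ 2)
    have h4 := (((hasDerivAt_id v).const_sub 1).mul h2).sub h3
    refine HasDerivAt.congr_deriv (f' := _) h4 ?_
    simp only [id]
    field_simp
    ring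
  rw [intervalIntegral.integral_eq_sub_of_hasDerivAt h]
  · simp; field_simp; ring
  · apply Continuous.intervalIntegrable; fun_prop

lemma fej_nonneg (w : ℝ) : 0 ≤ fej w := by
  by_cases hw : w = 0
  · subst hw
    unfold fej
    apply intervalIntegral.integral_nonneg (by norm_num)
    intro u hu
    simp; exact hu.2
  · rw [fej_eq hw]
    have := Real.cos_le_one w
    apply div_nonneg <;> nlinarith [sq_nonneg w]

lemma fej_zero : fej 0 = 1 / 2 := by
  unfold fej
  simp only [mul_zero, Real.cos_zero, mul_one]
  rw [intervalIntegral.integral_sub (by simp) (by simp)]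
  simp
  norm_num

lemma fej_continuous : Continuous fej := by
  unfold fej
  apply intervalIntegral.continuous_parametric_intervalIntegral_of_continuous'
  unfold Function.uncurry
  fun_prop

lemma fej_le (w : ℝ) : fej w ≤ 4 * (1 + w ^ 2)⁻¹ := by
  by_cases h1 : |w| ≤ 1
  · have : fej w ≤ 1 := by
      unfold fej
      calc _ ≤ ∫ v in (0:ℝ)..1, (1:ℝ) := by
            apply intervalIntegral.integral_mono_on (by norm_num)
            · apply Continuous.intervalIntegrable; fun_prop
            · simp
            · intro v hv
              have := Real.cos_le_one (v * w)
              have := Real.neg_one_le_cos (v * w)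
              nlinarith [hv.1, hv.2]
        _ = 1 := by simp
    have h2 : w ^ 2 ≤ 1 := by
      rw [← sq_abs]; nlinarith [abs_nonneg w]
    rw [← div_eq_mul_inv, le_div_iff₀ (by positivity)]
    nlinarith [fej_nonneg w]
  · push Not at h1
    have h2 : 1 < w ^ 2 := by
      rw [← sq_abs]; nlinarith [abs_nonneg w]
    have hw : w ≠ 0 := by rintro rfl; norm_num at h2
    rw [fej_eq hw, ← div_eq_mul_inv, div_le_div_iff₀ (by positivity) (by positivity)]
    nlinarith [Real.neg_one_le_cos w, Real.cos_le_one w]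

lemma fej_integrable : Integrable fej := by
  apply (integrable_inv_one_add_sq.const_mul 4).mono' fej_continuous.aestronglyMeasurable
  filter_upwards with w
  rw [Real.norm_of_nonneg (fej_nonneg w)]
  exact fej_le w

lemma fej_int_pos : 0 < ∫ w, fej w := by
  apply integral_pos_of_integrable_nonneg_nonzero fej_continuous fej_integrable fej_nonneg (x := 0)
  rw [fej_zero]; norm_num

/-- first half: the smoothed limit -/
lemma smooth_lim (g : ℝ → ℝ) (M : ℝ) (hg : Measurable g) (hM : ∀ u, |g u| ≤ M)
    (G : ℂ → ℂ) (hG : ContinuousOn G {z | 0 ≤ z.re})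
    (hL : ∀ z : ℂ, 0 < z.re → ∫ u in Set.Ioi (0:ℝ), (g u : ℂ) * Complex.exp (-z * u) = G z)
    (l : ℝ) (hl : 0 < l) (y : ℝ) :
    ∫ u in Set.Ioi (0:ℝ), g u * fej (l * (y - u)) =
      (∫ v in (0:ℝ)..1, ((1 - v : ℝ):ℂ) * (Complex.exp (Complex.I * (l * v * y : ℝ)) *
        G (Complex.I * (l * v : ℝ)))).re := by
  have hMn : 0 ≤ M := (abs_nonneg _).trans (hM 0)
  -- identity for positive σ
  have key : ∀ σ : ℝ, 0 < σ →
      ∫ u in Set.Ioi (0:ℝ), g u * Real.exp (-σ * u) * fej (l * (y - u)) =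
      (∫ v in (0:ℝ)..1, ((1 - v : ℝ):ℂ) * (Complex.exp (Complex.I * (l * v * y : ℝ)) *
        G (σ + Complex.I * (l * v : ℝ)))).re := by
    intro σ hσ
    have hint : Integrable (fun u => Real.exp (-σ * u)) (volume.restrict (Set.Ioi (0:ℝ))) :=
      exp_neg_integrableOn_Ioi 0 hσ
    have hprod : Integrable (Function.uncurry fun (u v : ℝ) =>
        ((1 - v : ℝ):ℂ) * (Complex.exp (Complex.I * (l * v * y : ℝ)) *
          ((g u : ℂ) * Complex.exp (-(σ + Complex.I * (l * v : ℝ)) * u))))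
        ((volume.restrict (Set.Ioi (0:ℝ))).prod (volume.restrict (Set.Ioc (0:ℝ) 1))) := by
      have h1 : Integrable (fun z : ℝ × ℝ => (M * Real.exp (-σ * z.1)) * (1 + |z.2|))
          ((volume.restrict (Set.Ioi (0:ℝ))).prod (volume.restrict (Set.Ioc (0:ℝ) 1))) := by
        apply (hint.const_mul M).mul_prod (g := fun v : ℝ => 1 + |v|)
        exact (Continuous.integrableOn_Ioc (by fun_prop))
      apply h1.mono'
      · apply Measurable.aestronglyMeasurable
        unfold Function.uncurry
        fun_prop
      · filter_upwards with z
        simp only [Function.uncurry, norm_mul, Complex.norm_exp, Complex.norm_real]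
        simp
        have h2 := hM z.1
        have h3 : |1 - z.2| ≤ 1 + |z.2| := by
          calc _ ≤ |(1:ℝ)| + |z.2| := abs_sub _ _
            _ = _ := by simp
        calc |1 - z.2| * (|g z.1| * Real.exp (-(σ * z.1)))
            ≤ (1 + |z.2|) * (M * Real.exp (-(σ * z.1))) := by gcongr
          _ = _ := by ring
    have hsw := integral_integral_swap hprod
    have hR : (∫ v in (0:ℝ)..1, ((1 - v : ℝ):ℂ) * (Complex.exp (Complex.I * (l * v * y : ℝ)) *
        G (σ + Complex.I * (l * v : ℝ)))) = ∫ v in Set.Ioc (0:ℝ) 1, ∫ u in Set.Ioi (0:ℝ), 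
        ((1 - v : ℝ):ℂ) * (Complex.exp (Complex.I * (l * v * y : ℝ)) *
          ((g u : ℂ) * Complex.exp (-(σ + Complex.I * (l * v : ℝ)) * u))) := by
      rw [intervalIntegral.integral_of_le (by norm_num)]
      congr 1
      ext v
      rw [integral_const_mul, integral_const_mul, hL _ (by simp [hσ])]
    rw [hR, ← hsw]
    have : ∀ z : ℂ, z.re = RCLike.re z := fun z => rfl
    rw [this, ← integral_re]
    swap
    · exact hprod.integral_prod_left
    congr 1
    ext u
    rw [← integral_re]
    swap
    · have : Continuous fun v : ℝ => ((1 - v : ℝ):ℂ) * (Complex.exp (Complex.I * (l * v * y : ℝ)) *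
          ((g u : ℂ) * Complex.exp (-(σ + Complex.I * (l * v : ℝ)) * u))) := by fun_prop
      exact this.integrableOn_Ioc
    unfold fej
    rw [intervalIntegral.integral_of_le (by norm_num), ← integral_const_mul]
    congr 1
    ext v
    have : Complex.exp (Complex.I * (l * v * y : ℝ)) * ((g u : ℂ) * Complex.exp (-(σ + Complex.I * (l * v : ℝ)) * u))
      = (g u * Real.exp (-σ * u) : ℝ) * Complex.exp ((v * (l * (y - u)) : ℝ) * Complex.I) := by
      rw [Complex.ofReal_mul (g u), Complex.ofReal_exp, mul_left_comm, mul_assoc (g u : ℂ), ← Complex.exp_add, ← Complex.exp_add]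
      congr 2
      push_cast
      ring
    rw [this]
    change _ = Complex.re _
    rw [Complex.re_ofReal_mul, Complex.re_ofReal_mul, Complex.exp_ofReal_mul_I_re]
    ring
  have lim1 : Tendsto (fun σ : ℝ => ∫ u in Set.Ioi (0:ℝ), g u * Real.exp (-σ * u) * fej (l * (y - u)))
      (nhdsWithin 0 (Set.Ioi 0)) (nhds (∫ u in Set.Ioi (0:ℝ), g u * fej (l * (y - u)))) := by
    have hK : Integrable (fun u => M * fej (l * (y - u))) := by
      have := (fej_integrable.comp_mul_left' hl.ne').comp_sub_left y
      exact this.const_mul M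
    apply tendsto_integral_filter_of_dominated_convergence (fun u => M * fej (l * (y - u)))
    · filter_upwards with σ
      apply Measurable.aestronglyMeasurable
      have := fej_continuous.measurable
      fun_prop
    · filter_upwards [self_mem_nhdsWithin] with σ hσ
      filter_upwards [ae_restrict_mem measurableSet_Ioi] with u hu
      rw [norm_mul, norm_mul, Real.norm_of_nonneg (fej_nonneg _), Real.norm_of_nonneg (Real.exp_pos _).le]
      gcongr
      · exact fej_nonneg _
      · have h1 : Real.exp (-σ * u) ≤ 1 := by
          rw [Real.exp_le_one_iff]
          have : 0 < σ * u := mul_pos hσ hu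
          linarith
        calc ‖g u‖ * Real.exp (-σ * u) ≤ M * 1 := by
              gcongr
              exact hM u
          _ = M := mul_one _
    · exact hK.restrict
    · filter_upwards with u
      have : Continuous fun σ : ℝ => g u * Real.exp (-σ * u) * fej (l * (y - u)) := by fun_prop
      have h2 := this.tendsto 0
      simp at h2
      exact (h2.mono_left nhdsWithin_le_nhds).congr (fun σ => by simp)
  have lim2 : Tendsto (fun σ : ℝ => (∫ v in (0:ℝ)..1, ((1 - v : ℝ):ℂ) * (Complex.exp (Complex.I * (l * v * y : ℝ)) *
        G (σ + Complex.I * (l * v : ℝ)))).re) (nhdsWithin 0 (Set.Ioi 0))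
        (nhds (∫ v in (0:ℝ)..1, ((1 - v : ℝ):ℂ) * (Complex.exp (Complex.I * (l * v * y : ℝ)) *
        G (Complex.I * (l * v : ℝ)))).re) := by
    apply (Complex.continuous_re.tendsto _).comp
    have hcomp : IsCompact ((fun q : ℝ × ℝ => (q.1 : ℂ) + Complex.I * (l * q.2 : ℝ)) '' (Set.Icc (0:ℝ) 1 ×ˢ Set.Icc (0:ℝ) 1)) :=
      (isCompact_Icc.prod isCompact_Icc).image (by fun_prop)
    obtain ⟨B, hB⟩ := hcomp.exists_bound_of_continuousOn (f := G) (hG.mono (by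
      rintro z ⟨q, hq, rfl⟩
      simpa using hq.1.1))
    have hGv : ∀ σ : ℝ, 0 ≤ σ → Continuous fun v : ℝ => G (σ + Complex.I * (l * v : ℝ)) := by
      intro σ hσ
      apply hG.comp_continuous (by fun_prop)
      intro v
      simpa using hσ
    apply intervalIntegral.tendsto_integral_filter_of_dominated_convergence (fun v => B)
    · filter_upwards [self_mem_nhdsWithin] with σ hσ
      have := hGv σ (le_of_lt hσ)
      apply Continuous.aestronglyMeasurable
      refine Continuous.mul (by fun_prop) (Continuous.mul (by fun_prop) this)
    · have : Set.Ioc (0:ℝ) 1 ∈ nhdsWithin (0:ℝ) (Set.Ioi 0) := Ioc_mem_nhdsGT (by norm_num)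
      filter_upwards [this] with σ hσ
      filter_upwards with v hv
      rw [Set.uIoc_of_le (by norm_num)] at hv
      rw [norm_mul, norm_mul, Complex.norm_exp, Complex.norm_real]
      have h1 := hB _ ⟨(σ, v), ⟨⟨hσ.1.le, hσ.2⟩, ⟨hv.1.le, hv.2⟩⟩, rfl⟩
      simp only at h1
      have h2 : ‖1 - v‖ ≤ 1 := by
        rw [Real.norm_eq_abs, abs_le]; constructor <;> linarith [hv.1, hv.2]
      have h3 : Real.exp (Complex.I * (l * v * y : ℝ)).re = 1 := by simp
      rw [h3, one_mul]
      calc _ ≤ 1 * B := by gcongr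
        _ = B := one_mul _
    · simp
    · filter_upwards with v hv
      have h1 : Tendsto (fun σ : ℝ => (σ : ℂ) + Complex.I * (l * v : ℝ)) (nhdsWithin 0 (Set.Ioi 0))
          (nhdsWithin (Complex.I * (l * v : ℝ)) {z | 0 ≤ z.re}) := by
        apply tendsto_nhdsWithin_of_tendsto_nhds_of_eventually_within
        · have : Continuous fun σ : ℝ => (σ : ℂ) + Complex.I * (l * v : ℝ) := by fun_prop
          have h2 := this.tendsto 0
          simp only [Complex.ofReal_zero, zero_add] at h2
          exact h2.mono_left nhdsWithin_le_nhds
        · filter_upwards [self_mem_nhdsWithin] with σ hσ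
          simpa using le_of_lt hσ
      have h2 := (hG (Complex.I * (l * v : ℝ)) (by simp)).tendsto.comp h1
      exact (h2.const_mul _).const_mul _
  refine tendsto_nhds_unique (lim1.congr' ?_) lim2
  filter_upwards [self_mem_nhdsWithin] with σ hσ
  exact key σ hσ

end FPT

namespace FPT
open MeasureTheory

lemma smooth_tendsto (g : ℝ → ℝ) (M : ℝ) (hg : Measurable g) (hM : ∀ u, |g u| ≤ M)
    (hg0 : ∀ u ≤ 0, g u = 0)
    (G : ℂ → ℂ) (hG : ContinuousOn G {z | 0 ≤ z.re})
    (hL : ∀ z : ℂ, 0 < z.re → ∫ u in Set.Ioi (0:ℝ), (g u : ℂ) * Complex.exp (-z * u) = G z)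
    (l : ℝ) (hl : 0 < l) :
    Tendsto (fun y => ∫ s, g (y - s / l) * fej s) atTop (nhds 0) := by
  have h1 : ∀ y, ∫ s, g (y - s / l) * fej s = l * ∫ u in Set.Ioi (0:ℝ), g u * fej (l * (y - u)) := by
    intro y
    have e1 : ∫ u in Set.Ioi (0:ℝ), g u * fej (l * (y - u)) = ∫ u, g u * fej (l * (y - u)) := by
      apply setIntegral_eq_integral_of_forall_compl_eq_zero
      intro u hu
      rw [hg0 u (by simpa using hu), zero_mul]
    rw [e1, ← integral_sub_left_eq_self (fun u => g u * fej (l * (y - u))) volume y]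
    have e2 := Measure.integral_comp_mul_left (fun s => g (y - s / l) * fej s) l
    have e3 : (fun x => g (y - l * x / l) * fej (l * x)) = fun x => g (y - x) * fej (l * (y - (y - x))) := by
      ext x
      rw [mul_div_cancel_left₀ _ hl.ne']
      simp
    rw [e3] at e2
    rw [e2, abs_of_pos (by positivity), smul_eq_mul, ← mul_assoc, mul_inv_cancel₀ hl.ne', one_mul]
  simp_rw [h1, smooth_lim g M hg hM G hG hL l hl]
  have RL := Real.tendsto_integral_exp_smul_cocompact (E := ℂ)
    (Set.indicator (Set.Ioc 0 1) fun v : ℝ => ((1 - v : ℝ):ℂ) * G (Complex.I * (l * v : ℝ)))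
  have hy : Tendsto (fun y : ℝ => -(l / (2 * Real.pi)) * y) atTop (cocompact ℝ) := by
    have : Tendsto (fun y : ℝ => -(l / (2 * Real.pi)) * y) atTop atBot := by
      apply Tendsto.const_mul_atTop_of_neg _ tendsto_id
      have := Real.pi_pos
      have : 0 < l / (2 * Real.pi) := by positivity
      linarith
    exact this.mono_right atBot_le_cocompact
  have h2 := (Complex.continuous_re.tendsto _).comp (RL.comp hy)
  have h3 := h2.const_mul l
  simp only [Complex.zero_re, mul_zero] at h3
  refine h3.congr fun y => ?_
  simp only [Function.comp]
  congr 2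
  rw [intervalIntegral.integral_of_le (by norm_num), ← integral_indicator measurableSet_Ioc]
  congr 1
  ext v
  by_cases hv : v ∈ Set.Ioc (0:ℝ) 1
  · rw [Set.indicator_of_mem hv, Set.indicator_of_mem hv, Circle.smul_def, Real.fourierChar_apply,
      smul_eq_mul, mul_left_comm]
    congr 3
    have := Real.pi_pos.ne'
    have : 2 * Real.pi * -(v * (-(l / (2 * Real.pi)) * y)) = l * v * y := by
      field_simp
    rw [this, mul_comm]
  · rw [Set.indicator_of_notMem hv, Set.indicator_of_notMem hv, smul_zero]

theorem tauberian (a : ℝ → ℝ) (c M : ℝ) (ha : Measurable a) (ha0 : ∀ u, 0 ≤ a u) (haM : ∀ u, a u ≤ M)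
    (hmono : ∀ u v, 0 < u → u ≤ v → a u * Real.exp u ≤ a v * Real.exp v)
    (G : ℂ → ℂ) (hG : ContinuousOn G {z | 0 ≤ z.re})
    (hL : ∀ z : ℂ, 0 < z.re → ∫ u in Set.Ioi (0:ℝ), ((a u - c : ℝ) : ℂ) * Complex.exp (-z * u) = G z) :
    Tendsto a atTop (nhds c) := by
  set g : ℝ → ℝ := Set.indicator (Set.Ioi 0) (fun u => a u - c) with hgdef
  have hM0 : 0 ≤ M := (ha0 0).trans (haM 0)
  set M' := M + |c| + 1 with hM'
  have hM'pos : 0 < M' := by positivity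
  have hgm : Measurable g := (ha.sub_const c).indicator measurableSet_Ioi
  have hgM : ∀ u, |g u| ≤ M' := by
    intro u
    by_cases hu : u ∈ Set.Ioi (0:ℝ)
    · rw [hgdef, Set.indicator_of_mem hu]
      calc |a u - c| ≤ |a u| + |c| := abs_sub _ _
        _ ≤ M' := by rw [abs_of_nonneg (ha0 u)]; linarith [haM u]
    · rw [hgdef, Set.indicator_of_notMem hu]; simpa using hM'pos.le
  have hst := smooth_tendsto g M' hgm hgM (fun u hu => by
      rw [hgdef, Set.indicator_of_notMem (by simpa using hu)]) G hG (fun z hz => by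
      rw [← hL z hz]
      apply setIntegral_congr_fun measurableSet_Ioi
      intro u hu
      simp only [hgdef, Set.indicator_of_mem hu])
  set I := ∫ w, fej w with hI
  have hIpos : 0 < I := fej_int_pos
  rw [Metric.tendsto_atTop']
  intro e he
  -- parameters
  obtain ⟨δ, hδ, hδ2⟩ : ∃ δ > 0, M * (Real.exp (2 * δ) - 1) < e / 4 := by
    have : Continuous fun δ : ℝ => M * (Real.exp (2 * δ) - 1) := by fun_prop
    have h2 := (this.tendsto 0)
    simp only [mul_zero, Real.exp_zero, sub_self] at h2
    have h3 := (h2.mono_left (nhdsWithin_le_nhds (s := Set.Ioi 0))).eventually (gt_mem_nhds (show 0 < e / 4 by positivity))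
    obtain ⟨δ, h4, h5⟩ := (h3.and self_mem_nhdsWithin).exists
    exact ⟨δ, h5, h4⟩
  obtain ⟨B, hB, hB1, hB2⟩ : ∃ B > 0, I / 2 < ∫ w in (-B)..B, fej w ∧
      M' * (I - ∫ w in (-B)..B, fej w) < e * I / 16 := by
    have h1 := intervalIntegral_tendsto_integral fej_integrable tendsto_neg_atTop_atBot (tendsto_id (α := ℝ) (x := atTop))
    have h2 := h1.eventually (lt_mem_nhds (show I / 2 < I by linarith))
    have h3 : Tendsto (fun B : ℝ => M' * (I - ∫ w in (-B)..B, fej w)) atTop (nhds 0) := by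
      have := (h1.const_sub I).const_mul M'
      rw [← hI, sub_self, mul_zero] at this
      exact this
    have h4 := h3.eventually (gt_mem_nhds (show 0 < e * I / 16 by positivity))
    obtain ⟨B, h5, h6, h7⟩ := (h2.and (h4.and (eventually_gt_atTop 0))).exists
    exact ⟨B, h7, h5, h6⟩
  set J := ∫ w in (-B)..B, fej w with hJ
  set l := B / δ with hl
  have hlpos : 0 < l := by positivity
  have hlim := hst l hlpos
  have hev : ∀ᶠ y in atTop, |∫ s, g (y - s / l) * fej s| < e * I / 16 := by
    have := hlim.abs
    rw [abs_zero] at this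
    exact this.eventually (gt_mem_nhds (by positivity))
  obtain ⟨Y, hY⟩ := eventually_atTop.1 hev
  -- split the integral
  have hint : ∀ y, Integrable (fun s => g (y - s / l) * fej s) := by
    intro y
    apply (fej_integrable.const_mul M').mono'
    · apply Measurable.aestronglyMeasurable
      have := fej_continuous.measurable
      fun_prop
    · filter_upwards with s
      rw [norm_mul, Real.norm_of_nonneg (fej_nonneg s)]
      exact mul_le_mul_of_nonneg_right (hgM _) (fej_nonneg s)
  have hJset : J = ∫ w in Set.Ioc (-B) B, fej w := by
    rw [hJ, intervalIntegral.integral_of_le (by linarith)]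
  have hcompl : ∫ w in (Set.Ioc (-B) B)ᶜ, fej w = I - J := by
    have := integral_add_compl (s := Set.Ioc (-B) B) measurableSet_Ioc fej_integrable
    rw [hJset]; linarith
  have hsplit : ∀ y, |(∫ s, g (y - s / l) * fej s) - ∫ s in Set.Ioc (-B) B, g (y - s / l) * fej s| ≤ M' * (I - J) := by
    intro y
    have := integral_add_compl (s := Set.Ioc (-B) B) measurableSet_Ioc (hint y)
    rw [← this, add_sub_cancel_left, ← hcompl, ← integral_const_mul, ← Real.norm_eq_abs]
    apply norm_integral_le_of_norm_le (fej_integrable.const_mul M').restrict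
    filter_upwards with s
    rw [norm_mul, Real.norm_of_nonneg (fej_nonneg s)]
    exact mul_le_mul_of_nonneg_right (hgM _) (fej_nonneg s)
  have hsmall : ∀ y ≥ Y, |∫ s in Set.Ioc (-B) B, g (y - s / l) * fej s| < e * I / 8 := by
    intro y hy
    have h1 := hsplit y
    have h2 := hY y hy
    rw [abs_le] at h1
    rw [abs_lt] at h2 ⊢
    constructor <;> linarith [h1.1, h1.2, h2.1, h2.2]
  have hsl : ∀ s ∈ Set.Ioc (-B) B, -δ ≤ s / l ∧ s / l ≤ δ := by
    intro s hs
    have hBl : δ = B / l := by rw [hl]; field_simp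
    rw [hBl]
    constructor
    · rw [← neg_div]; exact div_le_div_of_nonneg_right hs.1.le hlpos.le
    · exact div_le_div_of_nonneg_right hs.2 hlpos.le
  have hexp1 : 1 < Real.exp (2 * δ) := by simpa using hδ
  refine ⟨|Y| + 4 * δ + 1, fun y hy => ?_⟩
  have hYabs := le_abs_self Y
  have hYabs0 := abs_nonneg Y
  rw [Real.dist_eq, abs_lt]
  constructor
  · -- lower bound
    have h1 := hsmall (y - δ) (by linarith)
    have h2 : ∫ s in Set.Ioc (-B) B, g (y - δ - s / l) * fej s ≤ ∫ s in Set.Ioc (-B) B, (a y * Real.exp (2 * δ) - c) * fej s := by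
      apply setIntegral_mono_on (hint _).restrict (fej_integrable.const_mul _).restrict measurableSet_Ioc
      intro s hs
      obtain ⟨h3, h4⟩ := hsl s hs
      apply mul_le_mul_of_nonneg_right _ (fej_nonneg s)
      have h5 : 0 < y - δ - s / l := by linarith
      rw [hgdef, Set.indicator_of_mem (show y - δ - s / l ∈ Set.Ioi (0:ℝ) from h5)]
      have h6 := hmono (y - δ - s / l) y h5 (by linarith)
      have h7 : a (y - δ - s / l) ≤ a y * Real.exp (2 * δ) := by
        have : a (y - δ - s / l) ≤ a y * Real.exp (y - (y - δ - s / l)) := by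
          rw [Real.exp_sub, ← mul_div_assoc, le_div_iff₀ (Real.exp_pos _)]; exact h6
        refine this.trans (mul_le_mul_of_nonneg_left (Real.exp_le_exp.2 (by linarith)) (ha0 y))
      linarith
    rw [integral_const_mul, ← hJset] at h2
    have h3 := (abs_lt.1 h1).1
    have h4 : a y * (Real.exp (2 * δ) - 1) ≤ M * (Real.exp (2 * δ) - 1) :=
      mul_le_mul_of_nonneg_right (haM y) (by linarith)
    by_contra hcon
    push Not at hcon
    have h5 : a y * Real.exp (2 * δ) - c ≤ - (e / 2) := by linarith
    nlinarith
  · have h1 := hsmall (y + δ) (by linarith)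
    have h2 : ∫ s in Set.Ioc (-B) B, (a y * Real.exp (-(2 * δ)) - c) * fej s ≤ ∫ s in Set.Ioc (-B) B, g (y + δ - s / l) * fej s := by
      apply setIntegral_mono_on (fej_integrable.const_mul _).restrict (hint _).restrict measurableSet_Ioc
      intro s hs
      obtain ⟨h3, h4⟩ := hsl s hs
      apply mul_le_mul_of_nonneg_right _ (fej_nonneg s)
      have h5 : 0 < y + δ - s / l := by linarith
      rw [hgdef, Set.indicator_of_mem (show y + δ - s / l ∈ Set.Ioi (0:ℝ) from h5)]
      have h6 := hmono y (y + δ - s / l) (by linarith) (by linarith)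
      have h7 : a y * Real.exp (-(2 * δ)) ≤ a (y + δ - s / l) := by
        have : a y * Real.exp (y - (y + δ - s / l)) ≤ a (y + δ - s / l) := by
          rw [Real.exp_sub, ← mul_div_assoc, div_le_iff₀ (Real.exp_pos _)]; exact h6
        refine le_trans (mul_le_mul_of_nonneg_left (Real.exp_le_exp.2 (by linarith)) (ha0 y)) this
      linarith
    rw [integral_const_mul, ← hJset] at h2
    have h3 := (abs_lt.1 h1).2
    have hexp2 : 1 - Real.exp (-(2 * δ)) ≤ Real.exp (2 * δ) - 1 := by
      have := Real.add_one_le_exp (-(2 * δ))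
      have := Real.add_one_le_exp (2 * δ)
      linarith
    have hexp3 : Real.exp (-(2 * δ)) ≤ 1 := by rw [Real.exp_le_one_iff]; linarith
    have h4 : a y * (1 - Real.exp (-(2 * δ))) ≤ M * (Real.exp (2 * δ) - 1) :=
      mul_le_mul (haM y) hexp2 (by linarith) hM0
    by_contra hcon
    push Not at hcon
    have h5 : e / 2 ≤ a y * Real.exp (-(2 * δ)) - c := by linarith
    nlinarith

end FPT

namespace FPT
open MeasureTheory ArithmeticFunction.vonMangoldt

def psiAP {q : ℕ} (a : ZMod q) (x : ℝ) : ℝ := ∑ k ∈ Finset.Icc 1 ⌊x⌋₊, residueClass a k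

lemma psiAP_nonneg {q : ℕ} (a : ZMod q) (x : ℝ) : 0 ≤ psiAP a x :=
  Finset.sum_nonneg fun k _ => residueClass_nonneg a k

lemma psiAP_mono {q : ℕ} (a : ZMod q) : Monotone (psiAP a) := by
  intro x y h
  apply Finset.sum_le_sum_of_subset_of_nonneg
  · exact Finset.Icc_subset_Icc_right (Nat.floor_le_floor h)
  · intros; exact residueClass_nonneg a _

lemma psiAP_le {q : ℕ} (a : ZMod q) {x : ℝ} (hx : 0 ≤ x) : psiAP a x ≤ (Real.log 4 + 4) * x := by
  refine le_trans ?_ (Chebyshev.psi_le_const_mul_self hx)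
  unfold psiAP Chebyshev.psi
  rw [← Finset.Icc_add_one_left_eq_Ioc]
  exact Finset.sum_le_sum fun k _ => residueClass_le a k

theorem psiAP_tendsto {q : ℕ} [NeZero q] {a : ZMod q} (ha : IsUnit a) :
    Tendsto (fun x => psiAP a x / x) atTop (nhds ((q.totient : ℝ)⁻¹)) := by
  set c : ℝ := (q.totient : ℝ)⁻¹ with hc
  set b : ℝ → ℝ := fun u => psiAP a (Real.exp u) * Real.exp (-u) with hb
  have hbm : Measurable b := by
    have h1 := (psiAP_mono a).measurable
    have h2 : Measurable fun u : ℝ => psiAP a (Real.exp u) := h1.comp Real.measurable_exp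
    exact h2.mul (by fun_prop)
  have hb0 : ∀ u, 0 ≤ b u := fun u => mul_nonneg (psiAP_nonneg _ _) (Real.exp_pos _).le
  have hbM : ∀ u, b u ≤ Real.log 4 + 4 := by
    intro u
    calc b u ≤ ((Real.log 4 + 4) * Real.exp u) * Real.exp (-u) := by
          apply mul_le_mul_of_nonneg_right (psiAP_le a (Real.exp_pos _).le) (Real.exp_pos _).le
      _ = Real.log 4 + 4 := by rw [mul_assoc, ← Real.exp_add]; simp
  have hmul : ∀ u, b u * Real.exp u = psiAP a (Real.exp u) := by
    intro u
    simp only [hb]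
    rw [mul_assoc, ← Real.exp_add]; simp
  have hO : (fun n : ℕ ↦ ∑ k ∈ Finset.Icc 1 n, residueClass a k) =O[atTop] fun n ↦ (n : ℝ) ^ (1:ℝ) := by
    apply Asymptotics.IsBigO.of_bound (Real.log 4 + 4)
    filter_upwards with n
    have h1 := psiAP_le a (x := n) (by positivity)
    have h2 := psiAP_nonneg a n
    unfold psiAP at h1 h2
    rw [Nat.floor_natCast] at h1 h2
    rw [Real.norm_of_nonneg h2, Real.rpow_one, Real.norm_of_nonneg (by positivity)]
    exact h1
  have hT := tauberian b c (Real.log 4 + 4) hbm hb0 hbM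
    (fun u v _ huv => by
      rw [hmul, hmul]; exact psiAP_mono a (Real.exp_le_exp.2 huv))
    (fun z => (LFunctionResidueClassAux a (1 + z) - c) / (1 + z))
    (by
      apply ContinuousOn.div
      · apply ContinuousOn.sub _ continuousOn_const
        apply (continuousOn_LFunctionResidueClassAux a).comp (by fun_prop)
        intro z hz
        simpa using hz
      · fun_prop
      · intro z hz h0
        have := congrArg Complex.re h0
        simp at this hz
        linarith)
    (by
      intro z hz
      have hs : (1:ℝ) < (1 + z).re := by simpa using hz
      have h1 := LSeries_eq_mul_integral_of_nonneg (residueClass a) (zero_le_one) hs hO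
        (fun n => residueClass_nonneg a n)
      have hz0 : z ≠ 0 := by rintro rfl; simp at hz
      have hz1 : 1 + z ≠ 0 := by
        intro h0
        have := congrArg Complex.re h0
        simp at this hz
        linarith
      have h2 : ∫ t in Set.Ioi (1:ℝ), (∑ k ∈ Finset.Icc 1 ⌊t⌋₊, (residueClass a k : ℂ)) * (t:ℂ) ^ (-((1 + z) + 1))
          = ∫ u in Set.Ioi (0:ℝ), (b u : ℂ) * Complex.exp (-z * u) := by
        have himg : Real.exp '' (Set.Ioi 0) = Set.Ioi 1 := by
          ext t
          constructor
          · rintro ⟨u, hu, rfl⟩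
            simpa using hu
          · intro ht
            have ht' : (1:ℝ) < t := ht
            exact ⟨Real.log t, Real.log_pos ht', Real.exp_log (by linarith)⟩
        rw [← himg, integral_image_eq_integral_abs_deriv_smul measurableSet_Ioi
          (fun x _ => (Real.hasDerivAt_exp x).hasDerivWithinAt) Real.exp_injective.injOn]
        apply setIntegral_congr_fun measurableSet_Ioi
        intro u hu
        simp only
        have e1 : ((Real.exp u : ℝ) : ℂ) ^ (-((1 + z) + 1)) = Complex.exp (u * (-((1 + z) + 1))) := by
          rw [Complex.cpow_def_of_ne_zero (by exact_mod_cast (Real.exp_pos u).ne'), ← Complex.ofReal_log (Real.exp_pos u).le, Real.log_exp]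
        rw [e1, abs_of_pos (Real.exp_pos u), Complex.real_smul]
        simp only [hb, psiAP]
        push_cast
        rw [mul_left_comm, mul_assoc, ← Complex.exp_add, ← Complex.exp_add]
        congr 2
        ring
      rw [h2] at h1
      have h3 := eqOn_LFunctionResidueClassAux ha (show (1 + z) ∈ {s : ℂ | 1 < s.re} from hs)
      simp only at h3
      have hint0 : Integrable (fun u : ℝ => Complex.exp (-z * u)) (volume.restrict (Set.Ioi (0:ℝ))) :=
        integrableOn_exp_mul_complex_Ioi (by simpa using hz) 0
      have hint1 : Integrable (fun u : ℝ => (b u : ℂ) * Complex.exp (-z * u)) (volume.restrict (Set.Ioi (0:ℝ))) := by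
        apply (hint0.norm.const_mul (Real.log 4 + 4)).mono'
        · apply Measurable.aestronglyMeasurable
          fun_prop
        · filter_upwards with u
          rw [norm_mul, Complex.norm_real, Real.norm_of_nonneg (hb0 u)]
          exact mul_le_mul_of_nonneg_right (hbM u) (norm_nonneg _)
      have h4 : ∫ u in Set.Ioi (0:ℝ), ((b u - c : ℝ) : ℂ) * Complex.exp (-z * u)
          = (∫ u in Set.Ioi (0:ℝ), (b u : ℂ) * Complex.exp (-z * u)) - c * (1 / z) := by
        have e2 : ∫ u in Set.Ioi (0:ℝ), Complex.exp (-z * u) = 1 / z := by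
          rw [integral_exp_mul_complex_Ioi (by simpa using hz)]
          simp
        rw [← e2, ← integral_const_mul, ← integral_sub hint1 (hint0.const_mul _)]
        congr 1
        ext u
        push_cast
        ring
      rw [h4, h3, h1]
      have hcc : ((q.totient : ℂ))⁻¹ = (c : ℂ) := by rw [hc]; push_cast; rfl
      rw [hcc, add_sub_cancel_left]
      field_simp
      ring)
  have h5 := hT.comp Real.tendsto_log_atTop
  refine h5.congr' ?_
  filter_upwards [eventually_gt_atTop 0] with x hx
  simp only [Function.comp, hb]
  rw [Real.exp_neg, Real.exp_log hx, div_eq_mul_inv]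

def primesAP {q : ℕ} (a : ZMod q) (x : ℝ) : Finset ℕ :=
  (Finset.Icc 1 ⌊x⌋₊).filter fun p => p.Prime ∧ (p : ZMod q) = a

def thetaAP {q : ℕ} (a : ZMod q) (x : ℝ) : ℝ := ∑ p ∈ primesAP a x, Real.log p

lemma thetaAP_bounds {q : ℕ} (a : ZMod q) {x : ℝ} (hx : 1 ≤ x) :
    thetaAP a x ≤ psiAP a x ∧ psiAP a x - 2 * √x * Real.log x ≤ thetaAP a x := by
  have h1 : psiAP a x - thetaAP a x = ∑ k ∈ (Finset.Icc 1 ⌊x⌋₊).filter (fun k => ¬ k.Prime), residueClass a k := by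
    unfold psiAP thetaAP primesAP
    rw [← Finset.sum_filter_add_sum_filter_not (Finset.Icc 1 ⌊x⌋₊) (fun k => k.Prime)]
    have : ∑ p ∈ (Finset.Icc 1 ⌊x⌋₊).filter (fun p : ℕ => p.Prime ∧ (p : ZMod q) = a), Real.log (p:ℕ)
      = ∑ k ∈ (Finset.Icc 1 ⌊x⌋₊).filter (fun k => k.Prime), residueClass a k := by
      rw [← Finset.filter_filter, Finset.sum_filter]
      apply Finset.sum_congr rfl
      intro p hp
      have hp' := (Finset.mem_filter.1 hp).2
      unfold residueClass
      rw [Set.indicator_apply]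
      simp only [Set.mem_setOf_eq]
      rw [ArithmeticFunction.vonMangoldt_apply_prime hp']
    rw [this]; ring
  have h2 : 0 ≤ ∑ k ∈ (Finset.Icc 1 ⌊x⌋₊).filter (fun k => ¬ k.Prime), residueClass a k :=
    Finset.sum_nonneg fun k _ => residueClass_nonneg a k
  have h3 : ∑ k ∈ (Finset.Icc 1 ⌊x⌋₊).filter (fun k => ¬ k.Prime), residueClass a k ≤ 2 * √x * Real.log x := by
    refine le_trans ?_ (Chebyshev.psi_sub_theta_le hx)
    rw [Chebyshev.psi_sub_theta_eq_sum_not_prime, ← Finset.Icc_add_one_left_eq_Ioc]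
    exact Finset.sum_le_sum fun k _ => residueClass_le a k
  constructor <;> linarith

lemma loglim : Tendsto (fun x : ℝ => Real.log x / (Real.log x - 2 * Real.log (Real.log x))) atTop (nhds 1) := by
  have h1 : Tendsto (fun y : ℝ => Real.log y / y) atTop (nhds 0) :=
    Real.isLittleO_log_id_atTop.tendsto_div_nhds_zero
  have h2 : Tendsto (fun y : ℝ => (1 - 2 * (Real.log y / y))⁻¹) atTop (nhds 1) := by
    have := ((h1.const_mul 2).const_sub 1).inv₀ (by norm_num)
    simpa using this
  refine (h2.comp Real.tendsto_log_atTop).congr' ?_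
  filter_upwards [eventually_gt_atTop 1] with x hx
  have : 0 < Real.log x := Real.log_pos hx
  simp only [Function.comp]
  rw [show Real.log x - 2 * Real.log (Real.log x) = Real.log x * (1 - 2 * (Real.log (Real.log x) / Real.log x)) by
    field_simp]
  rw [div_mul_eq_div_div, div_self this.ne', one_div]

theorem piAP_tendsto {q : ℕ} [NeZero q] {a : ZMod q} (ha : IsUnit a) :
    Tendsto (fun x => Real.log x / x * ((primesAP a x).card : ℝ)) atTop (nhds ((q.totient : ℝ)⁻¹)) := by
  have hth : Tendsto (fun x => thetaAP a x / x) atTop (nhds ((q.totient : ℝ)⁻¹)) := by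
    have h1 := psiAP_tendsto ha
    have h2 : Tendsto (fun x : ℝ => 2 * √x * Real.log x / x) atTop (nhds 0) := by
      have h3 := (isLittleO_log_rpow_atTop (show (0:ℝ) < 1/2 by norm_num)).tendsto_div_nhds_zero
      have h4 := h3.const_mul 2
      rw [mul_zero] at h4
      refine h4.congr' ?_
      filter_upwards [eventually_gt_atTop 0] with x hx
      rw [← Real.sqrt_eq_rpow]
      have : 0 < √x := Real.sqrt_pos.2 hx
      have h5 : x = √x * √x := (Real.mul_self_sqrt hx.le).symm
      rw [mul_div_assoc', div_eq_div_iff this.ne' hx.ne']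
      linear_combination (2 * Real.log x) * h5
    have h3 := h1.sub h2
    rw [sub_zero] at h3
    refine tendsto_of_tendsto_of_tendsto_of_le_of_le' h3 h1 ?_ ?_
    · filter_upwards [eventually_ge_atTop 1] with x hx
      rw [← sub_div]
      exact div_le_div_of_nonneg_right (thetaAP_bounds a hx).2 (by linarith)
    · filter_upwards [eventually_ge_atTop 1] with x hx
      exact div_le_div_of_nonneg_right (thetaAP_bounds a hx).1 (by linarith)
  have hup : Tendsto (fun x : ℝ => (Real.log x)⁻¹ + (thetaAP a x / x) * (Real.log x / (Real.log x - 2 * Real.log (Real.log x)))) atTop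
      (nhds ((q.totient : ℝ)⁻¹)) := by
    have := (tendsto_inv_atTop_zero.comp Real.tendsto_log_atTop).add (hth.mul loglim)
    simpa using this
  refine tendsto_of_tendsto_of_tendsto_of_le_of_le' hth hup ?_ ?_
  · filter_upwards [eventually_ge_atTop 1] with x hx
    rw [div_mul_eq_mul_div]
    apply div_le_div_of_nonneg_right _ (by linarith)
    unfold thetaAP
    rw [mul_comm, ← nsmul_eq_mul]
    apply Finset.sum_le_card_nsmul
    intro p hp
    have hp' := Finset.mem_filter.1 hp
    have h1 := Finset.mem_Icc.1 hp'.1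
    apply Real.log_le_log (by exact_mod_cast h1.1)
    exact (Nat.le_floor_iff (by linarith)).1 h1.2
  · have hpos : ∀ᶠ x : ℝ in atTop, 0 < Real.log x - 2 * Real.log (Real.log x) := by
      have h1 := (Real.isLittleO_log_id_atTop.tendsto_div_nhds_zero).comp Real.tendsto_log_atTop
      filter_upwards [h1.eventually (gt_mem_nhds (show (0:ℝ) < 1/2 by norm_num)), eventually_gt_atTop 1] with x h2 hx
      have : 0 < Real.log x := Real.log_pos hx
      simp only [Function.comp, id] at h2
      rw [div_lt_iff₀ this] at h2
      linarith
    filter_upwards [hpos, eventually_gt_atTop (Real.exp 1)] with x hx hx1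
    have hlog : 1 < Real.log x := by
      rw [Real.lt_log_iff_exp_lt (by linarith [Real.exp_pos 1])]; exact hx1
    have hx0 : 0 < x := by linarith [Real.exp_pos 1]
    set y := x / (Real.log x) ^ 2 with hy
    have hy0 : 0 < y := by positivity
    have hlogy : Real.log y = Real.log x - 2 * Real.log (Real.log x) := by
      rw [hy, Real.log_div hx0.ne' (by positivity), Real.log_pow]; norm_num
    have hcard : ((primesAP a x).card : ℝ) ≤ y + thetaAP a x / Real.log y := by
      have e1 : (primesAP a x).card = ((primesAP a x).filter (fun p : ℕ => (p : ℝ) ≤ y)).card +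
          ((primesAP a x).filter (fun p : ℕ => ¬ (p : ℝ) ≤ y)).card :=
        (Finset.card_filter_add_card_filter_not _).symm
      have e2 : (((primesAP a x).filter (fun p : ℕ => (p : ℝ) ≤ y)).card : ℝ) ≤ y := by
        have : (primesAP a x).filter (fun p : ℕ => (p : ℝ) ≤ y) ⊆ Finset.Icc 1 ⌊y⌋₊ := by
          intro p hp
          have hp' := Finset.mem_filter.1 hp
          have hp2 := Finset.mem_Icc.1 (Finset.mem_filter.1 hp'.1).1
          exact Finset.mem_Icc.2 ⟨hp2.1, (Nat.le_floor_iff hy0.le).2 hp'.2⟩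
        have := Finset.card_le_card this
        rw [Nat.card_Icc, Nat.add_sub_cancel] at this
        calc _ ≤ ((⌊y⌋₊ : ℕ) : ℝ) := by exact_mod_cast this
          _ ≤ y := Nat.floor_le hy0.le
      have e3 : (((primesAP a x).filter (fun p : ℕ => ¬ (p : ℝ) ≤ y)).card : ℝ) * Real.log y ≤ thetaAP a x := by
        unfold thetaAP
        rw [← nsmul_eq_mul]
        calc _ ≤ ∑ p ∈ (primesAP a x).filter (fun p : ℕ => ¬ (p : ℝ) ≤ y), Real.log p := by
              apply Finset.card_nsmul_le_sum
              intro p hp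
              have hp' := (Finset.mem_filter.1 hp).2
              apply Real.log_le_log hy0 (by linarith)
          _ ≤ _ := by
              apply Finset.sum_le_sum_of_subset_of_nonneg (Finset.filter_subset _ _)
              intro p _ _
              exact Real.log_natCast_nonneg p
      rw [← le_div_iff₀ (by rw [hlogy]; exact hx)] at e3
      rw [e1]; push_cast; linarith
    calc _ ≤ Real.log x / x * (y + thetaAP a x / Real.log y) := by
          apply mul_le_mul_of_nonneg_left hcard (by positivity)
      _ = _ := by
          rw [hlogy, hy]
          field_simp

end FPT

namespace FPT

lemma sum_range_zmod {M : Type*} [AddCommMonoid M] (T : ℕ) [NeZero T] (f : ℕ → M) :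
    ∑ n ∈ range T, f n = ∑ a : ZMod T, f a.val := by
  refine Finset.sum_nbij' (fun n => (n : ZMod T)) ZMod.val ?_ ?_ ?_ ?_ ?_
  · intro n _; exact mem_univ _
  · intro a _; exact mem_range.2 (ZMod.val_lt a)
  · intro n hn; exact ZMod.val_cast_of_lt (mem_range.1 hn)
  · intro a _; exact ZMod.natCast_rightInverse a
  · intro n hn; rw [ZMod.val_cast_of_lt (mem_range.1 hn)]

lemma per_sum_zero (F : ℕ → ℤ) (T : ℕ) [NeZero T] (hmul : ∀ m n, F (m * n) = F m * F n)
    (hper : Function.Periodic F T) (k : ℕ) (hk : k.Coprime T) (hF : F k = -1) :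
    ∑ n ∈ range T, F n = 0 := by
  rw [sum_range_zmod]
  have h1 : ∑ a : ZMod T, F a.val = ∑ a : ZMod T, F ((ZMod.unitOfCoprime k hk : ZMod T) * a).val :=
    (Equiv.sum_comp (Units.mulLeft (ZMod.unitOfCoprime k hk)) (fun a : ZMod T => F a.val)).symm
  have h2 : ∀ a : ZMod T, F ((ZMod.unitOfCoprime k hk : ZMod T) * a).val = - F a.val := by
    intro a
    rw [ZMod.coe_unitOfCoprime, ZMod.val_mul, hper.map_mod_nat, hmul, ZMod.val_natCast,
      hper.map_mod_nat, hF]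
    ring
  simp only [h2, Finset.sum_neg_distrib] at h1
  linarith

lemma per_sum_range_le (F : ℕ → ℤ) (T : ℕ) [NeZero T] (hmul : ∀ m n, F (m * n) = F m * F n)
    (hper : Function.Periodic F T) (hb : ∀ n, |F n| ≤ 1) (k : ℕ) (hk : k.Coprime T) (hF : F k = -1)
    (N : ℕ) : |∑ n ∈ range N, F n| ≤ T := by
  induction N using Nat.strong_induction_on with
  | _ N ih =>
    by_cases h : N < T
    · calc |∑ n ∈ range N, F n| ≤ ∑ n ∈ range N, |F n| := Finset.abs_sum_le_sum_abs _ _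
        _ ≤ ∑ n ∈ range N, 1 := Finset.sum_le_sum fun n _ => hb n
        _ ≤ T := by simp; omega
    · obtain ⟨M, rfl⟩ : ∃ M, N = T + M := ⟨N - T, by omega⟩
      have hT : 0 < T := Nat.pos_of_ne_zero (NeZero.ne T)
      rw [Finset.sum_range_add, per_sum_zero F T hmul hper k hk hF, zero_add]
      have : ∀ x, F (T + x) = F x := fun x => by rw [add_comm, hper]
      simp only [this]
      exact ih M (by omega)

lemma per_zero (F : ℕ → ℤ) (hmul : ∀ m n, F (m * n) = F m * F n) (k : ℕ) (hF : F k = -1) : F 0 = 0 := by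
  have := hmul 0 k
  rw [zero_mul, hF] at this
  linarith

lemma sum_Icc_one (F : ℕ → ℤ) (h0 : F 0 = 0) (N : ℕ) : ∑ n ∈ Finset.Icc 1 N, F n = ∑ n ∈ range (N + 1), F n := by
  rw [Finset.sum_range_succ', h0, add_zero, Finset.range_eq_Ico, Finset.sum_Ico_add' F 0 N 1]
  rfl

lemma per_sum_le (F : ℕ → ℤ) (T : ℕ) [NeZero T] (hmul : ∀ m n, F (m * n) = F m * F n)
    (hper : Function.Periodic F T) (hb : ∀ n, |F n| ≤ 1) (k : ℕ) (hk : k.Coprime T) (hF : F k = -1)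
    (N : ℕ) : |∑ n ∈ Finset.Icc 1 N, F n| ≤ T := by
  rw [sum_Icc_one F (per_zero F hmul k hF)]
  exact per_sum_range_le F T hmul hper hb k hk hF _

lemma jac_mul (p m n : ℕ) : jacobiSym ((m * n : ℕ) : ℤ) p = jacobiSym m p * jacobiSym n p := by
  push_cast; exact jacobiSym.mul_left _ _ _

lemma jac_per (p : ℕ) : Function.Periodic (fun n : ℕ => jacobiSym (n : ℤ) p) p := by
  intro n
  simp only
  rw [jacobiSym.mod_left, jacobiSym.mod_left (n : ℤ)]
  push_cast
  rw [Int.add_emod_right]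

lemma jac_abs (a : ℤ) (n : ℕ) : |jacobiSym a n| ≤ 1 := by
  rcases jacobiSym.trichotomy a n with h | h | h <;> rw [h] <;> norm_num

lemma exists_nonres {p : ℕ} (hp : p.Prime) (hp2 : p ≠ 2) :
    ∃ k : ℕ, k.Coprime p ∧ jacobiSym (k : ℤ) p = -1 := by
  have := Fact.mk hp
  obtain ⟨a, ha⟩ := quadraticChar_exists_neg_one' (F := ZMod p) (by rwa [ZMod.ringChar_zmod_n])
  have h1 : jacobiSym ((a : ZMod p).val : ℤ) p = -1 := by
    rw [← jacobiSym.legendreSym.to_jacobiSym, legendreSym]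
    simpa using ha
  refine ⟨(a : ZMod p).val, ?_, h1⟩
  exact ZMod.val_coe_unit_coprime a

lemma S_self {p : ℕ} (hp : p.Prime) (hp2 : p ≠ 2) : S p p = 0 := by
  have : NeZero p := ⟨hp.ne_zero⟩
  obtain ⟨k, hk, hk1⟩ := exists_nonres hp hp2
  have h1 := per_sum_zero (fun n : ℕ => jacobiSym (n : ℤ) p) p (jac_mul p) (jac_per p) k hk hk1
  have h0 := per_zero (fun n : ℕ => jacobiSym (n : ℤ) p) (jac_mul p) k hk1
  unfold S
  rw [sum_Icc_one (fun n : ℕ => jacobiSym (n : ℤ) p) h0, Finset.sum_range_succ, h1, zero_add]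
  have := jac_per p 0
  simp only [zero_add] at this
  rw [this]; exact h0

lemma lt_fpt_iff {ε : ℝ} (hε : 0 < ε) {p : ℕ} (hp : p.Prime) (hp2 : p ≠ 2) (m : ℕ) :
    m < fpt ε p ↔ ∀ l ∈ Finset.Icc 1 m, ε * l ≤ S l p := by
  constructor
  · intro h l hl
    rw [mem_Icc] at hl
    have := Nat.notMem_of_lt_sInf (lt_of_le_of_lt hl.2 h)
    by_contra hc
    exact this ⟨hl.1, not_le.1 hc⟩
  · intro h
    by_contra hc
    push Not at hc
    have hne : {l : ℕ | 1 ≤ l ∧ ((S l p : ℝ)) < ε * l}.Nonempty := by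
      refine ⟨p, hp.one_lt.le, ?_⟩
      rw [S_self hp hp2]
      have : 0 < p := hp.pos
      push_cast; positivity
    have h1 := Nat.sInf_mem hne
    have h2 := h _ (mem_Icc.2 ⟨h1.1, hc⟩)
    exact absurd h1.2 (not_lt.2 h2)

lemma fpt_le {ε : ℝ} (hε : 0 < ε) {p : ℕ} (hp : p.Prime) (hp2 : p ≠ 2) : fpt ε p ≤ p := by
  apply Nat.sInf_le
  refine ⟨hp.one_lt.le, ?_⟩
  rw [S_self hp hp2]
  have : 0 < p := hp.pos
  push_cast; positivity

lemma S_congr {m Q : ℕ} (hQ : ∀ k ∈ Finset.Icc 1 m, 4 * k ∣ Q) {n n' : ℕ} (hn : Odd n) (hn' : Odd n')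
    (h : n ≡ n' [MOD Q]) {l : ℕ} (hl : l ≤ m) : S l n = S l n' := by
  unfold S
  apply Finset.sum_congr rfl
  intro k hk
  rw [mem_Icc] at hk
  rw [jacobiSym.mod_right _ hn, jacobiSym.mod_right _ hn', Int.natAbs_natCast]
  rw [h.of_dvd (hQ k (mem_Icc.2 ⟨hk.1, hk.2.trans hl⟩))]

lemma KL_aux (ε : ℝ) (m Q : ℕ) [NeZero Q] (h4 : 4 ∣ Q) (hQ : ∀ k ∈ Finset.Icc 1 m, 4 * k ∣ Q) (hε : 0 < ε)
    (a : ZMod Q) :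
    ∃ d : ℝ, 0 ≤ d ∧ (m = 0 → a = 1 → 0 < d) ∧
    Tendsto (fun x : ℝ => Real.log x / x *
      ((((oddPrimesUpTo x).filter (fun p => m < fpt ε p)).filter (fun p : ℕ => (p : ZMod Q) = a)).card : ℝ))
      atTop (nhds d) := by
  by_cases ha : IsUnit a
  · by_cases hg : ∀ l ∈ Finset.Icc 1 m, ε * l ≤ S l a.val
    · refine ⟨(Q.totient : ℝ)⁻¹, by positivity, ?_, ?_⟩
      · intro _ _
        have : 0 < Q.totient := Nat.totient_pos.2 (Nat.pos_of_ne_zero (NeZero.ne Q))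
        positivity
      · convert piAP_tendsto ha using 5 with x
        ext p
        simp only [oddPrimesUpTo, primesAP, mem_filter, mem_range, mem_Icc]
        constructor
        · rintro ⟨⟨⟨h1, h2, h3⟩, h5⟩, h6⟩
          exact ⟨⟨h2.one_lt.le, by omega⟩, h2, h6⟩
        · rintro ⟨⟨h1, h2⟩, h3, h5⟩
          have hp2 : p ≠ 2 := by
            rintro rfl
            have h6 : IsUnit ((2 : ℕ) : ZMod Q) := by rw [h5]; exact ha
            rw [ZMod.isUnit_iff_coprime] at h6
            have : 2 ∣ Q := (by norm_num : 2 ∣ 4).trans h4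
            have := Nat.Coprime.eq_one_of_dvd h6 this
            omega
          refine ⟨⟨⟨by omega, h3, hp2⟩, ?_⟩, h5⟩
          rw [lt_fpt_iff hε h3 hp2]
          intro l hl
          have hodd : Odd p := h3.odd_of_ne_two hp2
          have hav : a.val = p % Q := by rw [← h5, ZMod.val_natCast]
          have h2Q : 2 ∣ Q := (by norm_num : 2 ∣ 4).trans h4
          have hodd' : Odd a.val := by
            rw [hav, Nat.odd_iff, Nat.mod_mod_of_dvd _ h2Q, ← Nat.odd_iff]; exact hodd
          rw [S_congr hQ hodd hodd' (by rw [hav]; exact (Nat.mod_modEq _ _).symm) (mem_Icc.1 hl).2]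
          exact hg l hl
    · refine ⟨0, le_rfl, ?_, ?_⟩
      · rintro rfl _
        exact absurd (by simp) hg
      · refine tendsto_const_nhds.congr (fun x => ?_)
        have : (((oddPrimesUpTo x).filter (fun p => m < fpt ε p)).filter (fun p : ℕ => (p : ZMod Q) = a)) = ∅ := by
          rw [Finset.filter_eq_empty_iff]
          intro p hp h5
          rw [mem_filter] at hp
          obtain ⟨hp1, hp3⟩ := hp
          simp only [oddPrimesUpTo, mem_filter] at hp1
          obtain ⟨_, h3, hp2⟩ := hp1
          rw [lt_fpt_iff hε h3 hp2] at hp3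
          apply hg
          intro l hl
          have hodd : Odd p := h3.odd_of_ne_two hp2
          have hav : a.val = p % Q := by rw [← h5, ZMod.val_natCast]
          have h2Q : 2 ∣ Q := (by norm_num : 2 ∣ 4).trans h4
          have hodd' : Odd a.val := by
            rw [hav, Nat.odd_iff, Nat.mod_mod_of_dvd _ h2Q, ← Nat.odd_iff]; exact hodd
          rw [← S_congr hQ hodd hodd' (by rw [hav]; exact (Nat.mod_modEq _ _).symm) (mem_Icc.1 hl).2]
          exact hp3 l hl
        rw [this]; simp
  · refine ⟨0, le_rfl, ?_, ?_⟩
    · rintro _ rfl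
      exact absurd isUnit_one ha
    · have h1 : Tendsto (fun x : ℝ => Real.log x / x * (Q + 1 : ℝ)) atTop (nhds 0) := by
        simpa using (Real.isLittleO_log_id_atTop.tendsto_div_nhds_zero).mul_const (Q + 1 : ℝ)
      refine tendsto_of_tendsto_of_tendsto_of_le_of_le' tendsto_const_nhds h1 ?_ ?_
      · filter_upwards [eventually_ge_atTop 1] with x hx
        have := Real.log_nonneg hx
        positivity
      · filter_upwards [eventually_ge_atTop 1] with x hx
        have := Real.log_nonneg hx
        apply mul_le_mul_of_nonneg_left _ (by positivity)
        have : (((oddPrimesUpTo x).filter (fun p => m < fpt ε p)).filter (fun p : ℕ => (p : ZMod Q) = a)) ⊆ range (Q + 1) := by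
          intro p hp
          simp only [oddPrimesUpTo, mem_filter] at hp
          obtain ⟨⟨⟨_, h3, hp2⟩, _⟩, h5⟩ := hp
          rw [← h5, ZMod.isUnit_iff_coprime, Nat.Prime.coprime_iff_not_dvd h3, not_not] at ha
          rw [mem_range]
          have := Nat.le_of_dvd (Nat.pos_of_ne_zero (NeZero.ne Q)) ha
          omega
        have := Finset.card_le_card this
        rw [card_range] at this
        exact_mod_cast this

def gm (ε : ℝ) (m : ℕ) (x : ℝ) : ℝ :=
  Real.log x / x * ((((oddPrimesUpTo x).filter (fun p => m < fpt ε p))).card : ℝ)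

lemma KL (ε : ℝ) (hε : 0 < ε) (m : ℕ) :
    ∃ d : ℝ, 0 ≤ d ∧ (m = 0 → 0 < d) ∧ Tendsto (gm ε m) atTop (nhds d) := by
  set Q := 4 * m.factorial with hQd
  have : NeZero Q := ⟨by have := m.factorial_pos; omega⟩
  have hQ : ∀ k ∈ Finset.Icc 1 m, 4 * k ∣ Q := by
    intro k hk
    rw [mem_Icc] at hk
    exact Nat.mul_dvd_mul_left 4 (Nat.dvd_factorial hk.1 hk.2)
  choose d hd0 hd1 hd2 using KL_aux ε m Q (Dvd.intro _ rfl) hQ hε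
  refine ⟨∑ a : ZMod Q, d a, Finset.sum_nonneg fun a _ => hd0 a, ?_, ?_⟩
  · intro hm
    exact lt_of_lt_of_le (hd1 1 hm rfl) (Finset.single_le_sum (fun a _ => hd0 a) (mem_univ 1))
  · have h1 := tendsto_finsetSum (univ : Finset (ZMod Q)) (fun a _ => hd2 a)
    refine h1.congr ?_
    intro x
    unfold gm
    rw [← Finset.mul_sum]
    congr 1
    rw [Finset.card_eq_sum_card_fiberwise (f := fun p : ℕ => (p : ZMod Q)) (t := univ) (fun _ _ => by simp)]
    push_cast
    rfl

end FPT

namespace FPT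

lemma gm_tsum (ε : ℝ) (hε : 0 < ε) (x : ℝ) :
    ∑' m, gm ε m x = (Real.log x / x) * ∑ p ∈ oddPrimesUpTo x, (fpt ε p : ℝ) := by
  have hlt : ∀ p ∈ oddPrimesUpTo x, fpt ε p ≤ ⌊x⌋₊ := by
    intro p hp
    simp only [oddPrimesUpTo, mem_filter, mem_range] at hp
    exact (fpt_le hε hp.2.1 hp.2.2).trans (by omega)
  rw [tsum_eq_sum (s := range ⌊x⌋₊)]
  · unfold gm
    rw [← Finset.mul_sum]
    congr 1
    have h1 : ∀ m, (((oddPrimesUpTo x).filter (fun p => m < fpt ε p)).card : ℝ)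
        = ∑ p ∈ oddPrimesUpTo x, if m < fpt ε p then (1:ℝ) else 0 := by
      intro m; rw [Finset.card_filter]; push_cast; rfl
    simp only [h1]
    rw [Finset.sum_comm]
    apply Finset.sum_congr rfl
    intro p hp
    have h2 := hlt p hp
    rw [← Finset.sum_filter, Finset.sum_const, nsmul_eq_mul, mul_one]
    congr 1
    have : (range ⌊x⌋₊).filter (fun m => m < fpt ε p) = range (fpt ε p) := by
      ext m; simp only [mem_filter, mem_range]; omega
    rw [this, card_range]
  · intro m hm
    rw [mem_range] at hm
    unfold gm
    have : (oddPrimesUpTo x).filter (fun p => m < fpt ε p) = ∅ := by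
      rw [Finset.filter_eq_empty_iff]
      intro p hp
      have := hlt p hp
      omega
    rw [this]; simp

lemma final (ε : ℝ) (hε : 0 < ε)
    (hKB : ∃ C : ℝ, ∀ᶠ x in atTop, ∀ m : ℕ, 1 ≤ m → gm ε m x ≤ C * (m:ℝ)^(-(3/2) : ℝ)) :
    ∃ c : ℝ, 0 < c ∧
      Filter.Tendsto
        (fun x : ℝ => (Real.log x / x) * ∑ p ∈ oddPrimesUpTo x, (fpt ε p : ℝ))
        Filter.atTop (nhds c) := by
  obtain ⟨C, hC⟩ := hKB
  choose d hd0 hd1 hd2 using KL ε hε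
  set bound : ℕ → ℝ := fun m => (if m = 0 then d 0 + 1 else 0) + C * (m:ℝ)^(-(3/2) : ℝ) with hb
  have hsum : Summable bound := by
    apply Summable.add
    · apply summable_of_ne_finset_zero (s := {0})
      intro m hm
      rw [mem_singleton] at hm
      simp [hm]
    · apply Summable.mul_left
      rw [Real.summable_nat_rpow]; norm_num
  have hbd : ∀ᶠ x : ℝ in atTop, ∀ m, ‖gm ε m x‖ ≤ bound m := by
    filter_upwards [hC, eventually_ge_atTop 1, (hd2 0).eventually (gt_mem_nhds (lt_add_one (d 0)))] with x h1 h2 h3 m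
    have h0 : 0 ≤ gm ε m x := by
      unfold gm
      have := Real.log_nonneg h2
      positivity
    rw [Real.norm_of_nonneg h0]
    simp only [hb]
    by_cases hm : m = 0
    · subst hm
      simp only [if_true, Nat.cast_zero]
      rw [Real.zero_rpow (by norm_num)]
      linarith
    · simp only [hm, if_false, zero_add]
      exact h1 m (by omega)
  have h := tendsto_tsum_of_dominated_convergence hsum hd2 hbd
  have hds : Summable d := by
    apply Summable.of_nonneg_of_le hd0 _ hsum
    intro m
    refine le_of_tendsto (hd2 m) ?_
    filter_upwards [hbd] with x hx
    exact (le_abs_self _).trans (hx m)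
  refine ⟨∑' m, d m, ?_, ?_⟩
  · exact lt_of_lt_of_le (hd1 0 rfl) (hds.le_tsum 0 fun m _ => hd0 m)
  · simp only [gm_tsum ε hε] at h
    exact h

end FPT

namespace FPT

lemma succ_pow_le (e j : ℕ) : (e + 1) ^ j ≤ (j.factorial * 2 ^ j) * 2 ^ e := by
  calc (e + 1) ^ j ≤ (e + 1).ascFactorial j := Nat.pow_succ_le_ascFactorial _ _
    _ = j.factorial * (e + j).choose j := Nat.ascFactorial_eq_factorial_mul_choose _ _
    _ ≤ j.factorial * 2 ^ (e + j) := Nat.mul_le_mul_left _ (Nat.choose_le_two_pow _ _)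
    _ = _ := by rw [pow_add]; ring

lemma divisor_bound (j : ℕ) : ∃ C : ℕ, 1 ≤ C ∧ ∀ n : ℕ, 1 ≤ n → n.divisors.card ^ j ≤ C * n := by
  set C0 := j.factorial * 2 ^ j with hC0
  have hC01 : 1 ≤ C0 := Nat.mul_pos (Nat.factorial_pos j) (by positivity)
  refine ⟨C0 ^ (2 ^ j), Nat.one_le_pow _ _ hC01, ?_⟩
  intro n hn
  rw [Nat.card_divisors (by omega), ← Finset.prod_pow]
  calc ∏ p ∈ n.primeFactors, (n.factorization p + 1) ^ j
      ≤ ∏ p ∈ n.primeFactors, ((if p < 2 ^ j then C0 else 1) * p ^ n.factorization p) := by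
        apply Finset.prod_le_prod' 
        intro p hp
        have hp2 : 2 ≤ p := (Nat.prime_of_mem_primeFactors hp).two_le
        set e := n.factorization p
        split_ifs with h
        · exact (succ_pow_le e j).trans (Nat.mul_le_mul_left _ (Nat.pow_le_pow_left hp2 _))
        · push Not at h
          rw [one_mul]
          calc (e + 1) ^ j ≤ (2 ^ e) ^ j := Nat.pow_le_pow_left (Nat.lt_two_pow_self (n := e)) _
            _ = (2 ^ j) ^ e := by rw [← pow_mul, ← pow_mul, mul_comm]
            _ ≤ p ^ e := Nat.pow_le_pow_left h _
    _ = (∏ p ∈ n.primeFactors, (if p < 2 ^ j then C0 else 1)) * n := by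
        rw [Finset.prod_mul_distrib]
        congr 1
        exact Nat.prod_factorization_pow_eq_self (by omega)
    _ ≤ C0 ^ (2 ^ j) * n := by
        apply Nat.mul_le_mul_right
        rw [← Finset.prod_filter, Finset.prod_const]
        apply Nat.pow_le_pow_right hC01
        calc _ ≤ (range (2 ^ j)).card := by
              apply Finset.card_le_card
              intro p hp
              exact mem_range.2 (mem_filter.1 hp).2
          _ = _ := card_range _

/-- number of `k`-tuples in `[1,l]` with product `t` -/
def rk (l k t : ℕ) : ℕ :=
  ((Fintype.piFinset (fun _ : Fin k => Finset.Icc 1 l)).filter (fun v => ∏ i, v i = t)).card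

lemma rk_le (l k t : ℕ) (ht : 1 ≤ t) : rk l k t ≤ t.divisors.card ^ k := by
  unfold rk
  calc _ ≤ (Fintype.piFinset (fun _ : Fin k => t.divisors)).card := by
        apply Finset.card_le_card
        intro v hv
        rw [mem_filter] at hv
        rw [Fintype.mem_piFinset]
        intro i
        rw [Nat.mem_divisors]
        refine ⟨?_, by omega⟩
        rw [← hv.2]
        exact Finset.dvd_prod_of_mem _ (mem_univ i)
    _ = _ := by rw [Fintype.card_piFinset_const]

lemma rk_maps (l k : ℕ) : ∀ v ∈ Fintype.piFinset (fun _ : Fin k => Finset.Icc 1 l),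
    ∏ i, v i ∈ Finset.Icc 1 (l ^ k) := by
  intro v hv
  rw [Fintype.mem_piFinset] at hv
  simp only [mem_Icc] at hv ⊢
  constructor
  · exact Finset.one_le_prod' fun i _ => (hv i).1
  · calc ∏ i, v i ≤ ∏ i : Fin k, l := Finset.prod_le_prod' fun i _ => (hv i).2
      _ = l ^ k := by simp

lemma rk_expand (l k : ℕ) (f : ℕ → ℤ) (f1 : f 1 = 1) (hf : ∀ m n, f (m * n) = f m * f n) :
    (∑ n ∈ Finset.Icc 1 l, f n) ^ k = ∑ t ∈ Finset.Icc 1 (l ^ k), (rk l k t : ℤ) * f t := by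
  rw [Finset.sum_pow', ← Finset.sum_fiberwise_of_maps_to (rk_maps l k)]
  apply Finset.sum_congr rfl
  intro t _
  unfold rk
  rw [← nsmul_eq_mul]
  apply Finset.sum_eq_card_nsmul
  intro v hv
  rw [← (mem_filter.1 hv).2]
  let F : ℕ →* ℤ := { toFun := f, map_one' := f1, map_mul' := hf }
  exact (map_prod F v univ).symm

lemma S_pow (l k n : ℕ) :
    (S l n) ^ k = ∑ t ∈ Finset.Icc 1 (l ^ k), (rk l k t : ℤ) * jacobiSym (t : ℤ) n := by
  unfold S
  exact rk_expand l k (fun t => jacobiSym (t : ℤ) n) (by simp) (jac_mul n)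

lemma rk_sum (l k : ℕ) : ∑ t ∈ Finset.Icc 1 (l ^ k), rk l k t = l ^ k := by
  have := rk_expand l k (fun _ => 1) rfl (by simp)
  simp only [mul_one, sum_const, Nat.card_Icc, nsmul_eq_mul] at this
  have h2 : l + 1 - 1 = l := by omega
  rw [h2] at this
  exact_mod_cast this.symm

lemma nonsq_aux {a : ℕ} (ha : 1 ≤ a) (hsq : ¬ IsSquare a) :
    ∃ k : ℕ, Odd k ∧ k.Coprime a ∧ jacobiSym (a : ℤ) k = -1 := by
  obtain ⟨s, b, hab, hs⟩ := Nat.sq_mul_squarefree a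
  have hs0 : s ≠ 0 := by rintro rfl; omega
  have hsa : s ∣ a := ⟨b ^ 2, by rw [← hab]; ring⟩
  have hba : b ∣ a := ⟨b * s, by rw [← hab]; ring⟩
  have hjac : ∀ k : ℕ, k.Coprime a → jacobiSym (a : ℤ) k = jacobiSym (s : ℤ) k := by
    intro k hk
    rw [← hab]
    push_cast
    rw [jacobiSym.mul_left, jacobiSym.sq_one', one_mul]
    have := (hk.symm.coprime_dvd_left hba)
    simpa [Int.gcd_natCast_natCast] using this
  by_cases hq : ∃ q, q.Prime ∧ q ≠ 2 ∧ q ∣ s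
  · obtain ⟨q, hqp, hq2, s', hs'⟩ := hq
    have hqs' : q.Coprime s' := by
      rw [Nat.Prime.coprime_iff_not_dvd hqp]
      intro hd
      have : q * q ∣ s := by rw [hs']; exact Nat.mul_dvd_mul_left q hd
      exact hqp.one_lt.ne' (Nat.isUnit_iff.1 (hs q this))
    set M := ordCompl[q] a with hM
    have hqM : q.Coprime M := Nat.coprime_ordCompl hqp (by omega)
    have haM : ordProj[q] a * M = a := Nat.ordProj_mul_ordCompl_eq_self a q
    have hs'M : s' ∣ M := by
      have h1 : s' ∣ ordProj[q] a * M := by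
        rw [haM]; exact (Dvd.intro_left q hs'.symm).trans hsa
      exact (Nat.Coprime.pow_right _ hqs'.symm).dvd_of_dvd_mul_left h1
    obtain ⟨u, hu, hu1⟩ := exists_nonres hqp hq2
    have hcop : (8 * M).Coprime q := by
      apply Nat.Coprime.mul_left _ hqM.symm
      rw [Nat.coprime_comm, Nat.Prime.coprime_iff_not_dvd hqp]
      intro h
      have : q ∣ 2 := hqp.dvd_of_dvd_pow (show q ∣ 2 ^ 3 from h)
      exact hq2 ((Nat.prime_dvd_prime_iff_eq hqp Nat.prime_two).1 this)
    obtain ⟨k, hk1, hk2⟩ := Nat.chineseRemainder hcop 1 u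
    have hk8 : k % 4 = 1 := by
      have := hk1.of_dvd (show 4 ∣ 8 * M from ⟨2 * M, by ring⟩)
      exact this
    have hodd : Odd k := by rw [Nat.odd_iff]; omega
    have hkM : k.Coprime M := by
      have := hk1.of_dvd (show M ∣ 8 * M from ⟨8, by ring⟩)
      have := this.gcd_eq
      rw [Nat.gcd_one_left] at this
      exact this
    have hkq : k.Coprime q := by
      have := hk2.gcd_eq
      rw [hu] at this
      exact this
    have hka : k.Coprime a := by
      rw [← haM]
      exact Nat.Coprime.mul_right (Nat.Coprime.pow_right _ hkq) hkM
    refine ⟨k, hodd, hka, ?_⟩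
    rw [hjac k hka, hs']
    push_cast
    rw [jacobiSym.mul_left]
    have e1 : jacobiSym (s' : ℤ) k = 1 := by
      have h1 := jacobiSym.mod_right' s' hodd
      have h2 : k % (4 * s') = 1 % (4 * s') :=
        hk1.of_dvd ((Nat.mul_dvd_mul_left 4 hs'M).trans ⟨2, by ring⟩)
      have h3 := jacobiSym.mod_right' s' (b := 1) odd_one
      rw [h1, h2, ← h3, jacobiSym.one_right]
    have e2 : jacobiSym (q : ℤ) k = -1 := by
      rw [jacobiSym.quadratic_reciprocity_one_mod_four' (hqp.odd_of_ne_two hq2) hk8, ← hu1]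
      apply jacobiSym.mod_left'
      exact_mod_cast hk2
    rw [e1, e2]; norm_num
  · push Not at hq
    have h2 : ∀ {d : ℕ}, d.Prime → d ∣ s → d = 2 := by
      intro d hd hds
      by_contra h
      exact hq d hd h hds
    have hs2 : s = 2 := by
      have h3 := Nat.eq_prime_pow_of_unique_prime_dvd hs0 h2
      rcases Nat.lt_or_ge s.primeFactorsList.length 2 with h | h
      · interval_cases hl : s.primeFactorsList.length
        · exfalso
          apply hsq
          rw [← hab, h3]
          exact ⟨b, by ring⟩
        · rw [h3]; norm_num
      · exfalso
        have : 2 * 2 ∣ s := by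
          rw [h3, ← pow_two]
          exact pow_dvd_pow 2 h
        have := Nat.isUnit_iff.1 (hs 2 this)
        omega
    set M := ordCompl[2] a with hM
    have hqM : Nat.Coprime 2 M := Nat.coprime_ordCompl Nat.prime_two (by omega)
    have haM : ordProj[2] a * M = a := Nat.ordProj_mul_ordCompl_eq_self a 2
    have hcop : Nat.Coprime 8 M := Nat.Coprime.pow_left 3 hqM
    obtain ⟨k, hk1, hk2⟩ := Nat.chineseRemainder hcop 5 1
    have hk8 : k % 8 = 5 := hk1
    have hodd : Odd k := by rw [Nat.odd_iff]; omega
    have hkM : k.Coprime M := by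
      have := hk2.gcd_eq
      rw [Nat.gcd_one_left] at this
      exact this
    have hka : k.Coprime a := by
      rw [← haM]
      exact Nat.Coprime.mul_right (Nat.Coprime.pow_right _ (Nat.coprime_two_right.2 hodd)) hkM
    refine ⟨k, hodd, hka, ?_⟩
    rw [hjac k hka, hs2]
    push_cast
    rw [jacobiSym.at_two hodd, ZMod.χ₈_nat_mod_eight, hk8]
    decide

/-- `J(a|k)` supported on odd `k` -/
def Jo (a k : ℕ) : ℤ := if Odd k then jacobiSym (a : ℤ) k else 0

lemma Jo_mul (a m n : ℕ) : Jo a (m * n) = Jo a m * Jo a n := by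
  unfold Jo
  by_cases hm : Odd m
  · by_cases hn : Odd n
    · have h1 : m ≠ 0 := by rintro rfl; simp at hm
      have h2 : n ≠ 0 := by rintro rfl; simp at hn
      simp only [hm, hn, hm.mul hn, if_true]
      exact jacobiSym.mul_right' _ h1 h2
    · simp [Nat.odd_mul, hn]
  · simp [Nat.odd_mul, hm]

lemma Jo_abs (a n : ℕ) : |Jo a n| ≤ 1 := by
  unfold Jo
  split_ifs
  · exact jac_abs _ _
  · simp

lemma Jo_per (a : ℕ) : Function.Periodic (Jo a) (4 * a) := by
  intro n
  unfold Jo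
  have h : Odd (n + 4 * a) ↔ Odd n := by
    rw [Nat.odd_iff, Nat.odd_iff]; omega
  by_cases hn : Odd n
  · simp only [h, hn, if_true]
    rw [jacobiSym.mod_right' a (h.2 hn), jacobiSym.mod_right' a hn, Nat.add_mod_right]
  · simp only [h, hn, if_false]

lemma Jo_sum_le {a : ℕ} (ha : 1 ≤ a) (hsq : ¬ IsSquare a) (N : ℕ) :
    |∑ n ∈ Finset.Icc 1 N, Jo a n| ≤ 4 * a := by
  obtain ⟨k, hk, hka, hk1⟩ := nonsq_aux ha hsq
  have : NeZero (4 * a) := ⟨by omega⟩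
  have h := per_sum_le (Jo a) (4 * a) (Jo_mul a) (Jo_per a) (Jo_abs a) k ?_ ?_ N
  · exact_mod_cast h
  · exact Nat.Coprime.mul_right (Nat.Coprime.pow_right 2 (Nat.coprime_two_right.2 hk)) hka
  · unfold Jo; simp only [hk, if_true]; exact hk1

lemma jj_sum_le {p q : ℕ} (hp : p.Prime) (hq : q.Prime) (hp2 : p ≠ 2) (hpq : p ≠ q) (N : ℕ) :
    |∑ n ∈ Finset.Icc 1 N, jacobiSym (n : ℤ) p * jacobiSym (n : ℤ) q| ≤ p * q := by
  have : NeZero (p * q) := ⟨Nat.mul_ne_zero hp.ne_zero hq.ne_zero⟩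
  have hc : p.Coprime q := (Nat.coprime_primes hp hq).2 hpq
  obtain ⟨u, hu, hu1⟩ := exists_nonres hp hp2
  obtain ⟨k, hk1, hk2⟩ := Nat.chineseRemainder hc u 1
  have h := per_sum_le (fun n : ℕ => jacobiSym (n : ℤ) p * jacobiSym (n : ℤ) q) (p * q) ?_ ?_ ?_ k ?_ ?_ N
  · exact_mod_cast h
  · intro m n
    rw [jac_mul, jac_mul]; ring
  · intro n
    simp only
    congr 1
    · have := (jac_per p).nat_mul q n
      rw [mul_comm p q]
      exact_mod_cast this
    · have := (jac_per q).nat_mul p n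
      exact_mod_cast this
  · intro n
    rw [abs_mul]
    exact mul_le_one₀ (jac_abs _ _) (abs_nonneg _) (jac_abs _ _)
  · apply Nat.Coprime.mul_right
    · have := hk1.gcd_eq
      rw [hu] at this
      exact this
    · have := hk2.gcd_eq
      rw [Nat.gcd_one_left] at this
      exact this
  · have e1 : jacobiSym (k : ℤ) p = -1 := by
      rw [← hu1]
      apply jacobiSym.mod_left'
      exact_mod_cast hk1
    have e2 : jacobiSym (k : ℤ) q = 1 := by
      rw [← jacobiSym.one_left q]
      apply jacobiSym.mod_left'
      exact_mod_cast hk2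
    rw [e1, e2]; norm_num

end FPT

namespace FPT

def hs (k : ℕ) : ℝ := ((ArithmeticFunction.moebius k : ℤ) : ℝ) ^ 2 / (k.totient : ℝ)

lemma hs_nonneg (k : ℕ) : 0 ≤ hs k := by unfold hs; positivity

def GG (D : ℕ) : ℝ := ∑ k ∈ Finset.Icc 1 D, hs k

def lam (D d : ℕ) : ℝ := (((ArithmeticFunction.moebius d : ℤ) : ℝ) * d / GG D) *
  ∑ k ∈ (Finset.Icc 1 D).filter (fun k => d ∣ k), hs k

lemma GG_pos {D : ℕ} (hD : 1 ≤ D) : 0 < GG D := by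
  unfold GG
  have h : hs 1 = 1 := by simp [hs]
  have := Finset.single_le_sum (f := hs) (fun k _ => hs_nonneg k) (mem_Icc.2 ⟨le_rfl, hD⟩ : 1 ∈ Finset.Icc 1 D)
  linarith

lemma lam_one {D : ℕ} (hD : 1 ≤ D) : lam D 1 = 1 := by
  unfold lam
  have : (Finset.Icc 1 D).filter (fun k => 1 ∣ k) = Finset.Icc 1 D := by
    apply Finset.filter_true_of_mem; intro k _; exact one_dvd k
  rw [this]
  change _ * GG D = 1
  have := GG_pos hD
  simp
  field_simp

lemma lam_abs {D : ℕ} (hD : 1 ≤ D) (d : ℕ) : |lam D d| ≤ d := by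
  have hG := GG_pos hD
  unfold lam
  have h1 : ∑ k ∈ (Finset.Icc 1 D).filter (fun k => d ∣ k), hs k ≤ GG D :=
    Finset.sum_le_sum_of_subset_of_nonneg (Finset.filter_subset _ _) fun k _ _ => hs_nonneg k
  have h0 : 0 ≤ ∑ k ∈ (Finset.Icc 1 D).filter (fun k => d ∣ k), hs k :=
    Finset.sum_nonneg fun k _ => hs_nonneg k
  have h2 : |((ArithmeticFunction.moebius d : ℤ) : ℝ)| ≤ 1 := by
    exact_mod_cast ArithmeticFunction.abs_moebius_le_one
  rw [abs_mul, abs_div, abs_mul, abs_of_pos hG, abs_of_nonneg h0, Nat.abs_cast]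
  calc _ ≤ (1 * (d : ℝ) / GG D) * GG D := by gcongr
    _ = d := by field_simp

lemma moebius_sum_aux {c k : ℕ} (hk : Squarefree k) (hck : c ∣ k) :
    ∑ d ∈ k.divisors.filter (fun d => c ∣ d), ArithmeticFunction.moebius d
      = if c = k then ArithmeticFunction.moebius c else 0 := by
  obtain ⟨e, rfl⟩ := hck
  have hc0 : c ≠ 0 := by rintro rfl; simp at hk
  have he0 : e ≠ 0 := by rintro rfl; simp at hk
  have hco : c.Coprime e := Nat.coprime_of_squarefree_mul hk
  have h1 : ∑ d ∈ (c * e).divisors.filter (fun d => c ∣ d), ArithmeticFunction.moebius d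
      = ∑ f ∈ e.divisors, ArithmeticFunction.moebius (c * f) := by
    symm
    refine Finset.sum_nbij (fun f => c * f) ?_ ?_ ?_ ?_
    · intro f hf
      rw [Nat.mem_divisors] at hf
      rw [mem_filter, Nat.mem_divisors]
      exact ⟨⟨Nat.mul_dvd_mul_left c hf.1, Nat.mul_ne_zero hc0 he0⟩, Dvd.intro _ rfl⟩
    · intro f _ g _ h
      exact Nat.eq_of_mul_eq_mul_left (Nat.pos_of_ne_zero hc0) h
    · intro d hd
      rw [mem_coe, mem_filter, Nat.mem_divisors] at hd
      obtain ⟨⟨hd1, _⟩, f, rfl⟩ := hd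
      refine ⟨f, ?_, rfl⟩
      rw [mem_coe, Nat.mem_divisors]
      exact ⟨Nat.dvd_of_mul_dvd_mul_left (Nat.pos_of_ne_zero hc0) hd1, he0⟩
    · intro f _; rfl
  rw [h1]
  have h2 : ∀ f ∈ e.divisors, ArithmeticFunction.moebius (c * f)
      = ArithmeticFunction.moebius c * ArithmeticFunction.moebius f := by
    intro f hf
    exact ArithmeticFunction.isMultiplicative_moebius.map_mul_of_coprime
      (hco.coprime_dvd_right (Nat.dvd_of_mem_divisors hf))
  rw [Finset.sum_congr rfl h2, ← Finset.mul_sum]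
  have h3 : ∑ f ∈ e.divisors, ArithmeticFunction.moebius f = if e = 1 then 1 else 0 := by
    have := congrArg (fun F => F e) ArithmeticFunction.moebius_mul_coe_zeta
    simp only [ArithmeticFunction.coe_mul_zeta_apply] at this
    rw [this, ArithmeticFunction.one_apply]
  rw [h3]
  by_cases he : e = 1
  · simp [he]
  · have : c ≠ c * e := by
      intro h
      exact he (Nat.eq_of_mul_eq_mul_left (Nat.pos_of_ne_zero hc0) (by rw [mul_one]; exact h.symm))
    simp only [he, this, if_false, mul_zero]

lemma y_eq {D : ℕ} {c : ℕ} (hc : c ∈ Finset.Icc 1 D) :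
    ∑ d ∈ (Finset.Icc 1 D).filter (fun d => c ∣ d), lam D d / d
      = ((ArithmeticFunction.moebius c : ℤ) : ℝ) * hs c / GG D := by
  have h1 : ∀ d ∈ (Finset.Icc 1 D).filter (fun d => c ∣ d), lam D d / d =
      (∑ k ∈ Finset.Icc 1 D, if d ∣ k then hs k * ((ArithmeticFunction.moebius d : ℤ) : ℝ) else 0) / GG D := by
    intro d hd
    have hd0 : (d : ℝ) ≠ 0 := by
      have := (mem_Icc.1 (mem_filter.1 hd).1).1
      positivity
    unfold lam
    rw [Finset.sum_filter, Finset.mul_sum, Finset.sum_div, Finset.sum_div]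
    apply Finset.sum_congr rfl
    intro k _
    split_ifs
    · field_simp
    · simp
  rw [Finset.sum_congr rfl h1, ← Finset.sum_div]
  congr 1
  rw [Finset.sum_comm]
  have h2 : ∀ k ∈ Finset.Icc 1 D, ∑ d ∈ (Finset.Icc 1 D).filter (fun d => c ∣ d),
      (if d ∣ k then hs k * ((ArithmeticFunction.moebius d : ℤ) : ℝ) else 0)
      = if k = c then ((ArithmeticFunction.moebius c : ℤ) : ℝ) * hs c else 0 := by
    intro k hk
    rw [mem_Icc] at hk
    by_cases hsq : Squarefree k
    · rw [← Finset.sum_filter, ← Finset.mul_sum]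
      have hset : ((Finset.Icc 1 D).filter (fun d => c ∣ d)).filter (fun d => d ∣ k)
          = k.divisors.filter (fun d => c ∣ d) := by
        ext d
        simp only [mem_filter, mem_Icc, Nat.mem_divisors]
        constructor
        · rintro ⟨⟨_, h1⟩, h2⟩; exact ⟨⟨h2, by omega⟩, h1⟩
        · rintro ⟨⟨h2, _⟩, h1⟩
          have := Nat.le_of_dvd (by omega) h2
          have := Nat.pos_of_dvd_of_pos h2 (by omega)
          exact ⟨⟨⟨by omega, by omega⟩, h1⟩, h2⟩
      rw [hset]
      by_cases hck : c ∣ k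
      · have := moebius_sum_aux hsq hck
        have h3 : (∑ d ∈ k.divisors.filter (fun d => c ∣ d), ((ArithmeticFunction.moebius d : ℤ) : ℝ))
          = ((if c = k then ArithmeticFunction.moebius c else 0 : ℤ) : ℝ) := by
          rw [← this]; push_cast; rfl
        rw [h3]
        by_cases hkc : k = c
        · subst hkc; simp; ring
        · have : c ≠ k := fun h => hkc h.symm
          simp [hkc, this]
      · have hkc : k ≠ c := by rintro rfl; exact hck dvd_rfl
        have : k.divisors.filter (fun d => c ∣ d) = ∅ := by
          rw [Finset.filter_eq_empty_iff]
          intro d hd h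
          exact hck (h.trans (Nat.dvd_of_mem_divisors hd))
        rw [this]; simp [hkc]
    · have hz : hs k = 0 := by
        unfold hs
        rw [ArithmeticFunction.moebius_eq_zero_of_not_squarefree hsq]; simp
      have hz' : k = c → hs c = 0 := by rintro rfl; exact hz
      rw [Finset.sum_eq_zero]
      · split_ifs with h
        · rw [hz' h, mul_zero]
        · rfl
      · intro d _; rw [hz]; simp
  rw [Finset.sum_congr rfl h2, Finset.sum_ite_eq' (Finset.Icc 1 D) c]
  simp [hc]

lemma lam_quad {D : ℕ} (hD : 1 ≤ D) :
    ∑ d ∈ Finset.Icc 1 D, ∑ e ∈ Finset.Icc 1 D, lam D d * lam D e / (Nat.lcm d e : ℝ) = 1 / GG D := by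
  have hG := GG_pos hD
  have h1 : ∀ d ∈ Finset.Icc 1 D, ∀ e ∈ Finset.Icc 1 D, lam D d * lam D e / (Nat.lcm d e : ℝ)
      = ∑ c ∈ Finset.Icc 1 D, (c.totient : ℝ) * ((if c ∣ d then lam D d / d else 0) * (if c ∣ e then lam D e / e else 0)) := by
    intro d hd e he
    rw [mem_Icc] at hd he
    have hd0 : (d : ℝ) ≠ 0 := by have := hd.1; positivity
    have he0 : (e : ℝ) ≠ 0 := by have := he.1; positivity
    have hl : (Nat.gcd d e : ℝ) * (Nat.lcm d e : ℝ) = d * e := by exact_mod_cast Nat.gcd_mul_lcm d e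
    have hl0 : (Nat.lcm d e : ℝ) ≠ 0 := by
      intro h; rw [h, mul_zero] at hl
      exact mul_ne_zero hd0 he0 hl.symm
    have hg : (Nat.gcd d e : ℝ) = ∑ c ∈ Finset.Icc 1 D, if c ∣ d ∧ c ∣ e then (c.totient : ℝ) else 0 := by
      rw [← Finset.sum_filter]
      have := Nat.sum_totient (Nat.gcd d e)
      have hset : (Finset.Icc 1 D).filter (fun c => c ∣ d ∧ c ∣ e) = (Nat.gcd d e).divisors := by
        ext c
        simp only [mem_filter, mem_Icc, Nat.mem_divisors, Nat.dvd_gcd_iff]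
        constructor
        · rintro ⟨_, h⟩
          exact ⟨h, (Nat.gcd_pos_of_pos_left _ (by omega)).ne'⟩
        · rintro ⟨h, _⟩
          have := Nat.le_of_dvd (by omega) h.1
          have := Nat.pos_of_dvd_of_pos h.1 (by omega)
          exact ⟨⟨by omega, by omega⟩, h⟩
      rw [hset]
      exact_mod_cast this.symm
    have h2 : lam D d * lam D e / (Nat.lcm d e : ℝ) = (Nat.gcd d e : ℝ) * ((lam D d / d) * (lam D e / e)) := by
      field_simp
      linear_combination -(lam D d * lam D e) * hl
    rw [h2, hg, Finset.sum_mul]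
    apply Finset.sum_congr rfl
    intro c _
    by_cases hcd : c ∣ d <;> by_cases hce : c ∣ e <;> simp [hcd, hce]
  have h2 : ∑ d ∈ Finset.Icc 1 D, ∑ e ∈ Finset.Icc 1 D, lam D d * lam D e / (Nat.lcm d e : ℝ)
      = ∑ c ∈ Finset.Icc 1 D, (c.totient : ℝ) * (∑ d ∈ (Finset.Icc 1 D).filter (fun d => c ∣ d), lam D d / d) ^ 2 := by
    rw [Finset.sum_congr rfl fun d hd => Finset.sum_congr rfl (h1 d hd)]
    rw [Finset.sum_congr rfl fun d _ => Finset.sum_comm]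
    rw [Finset.sum_comm]
    apply Finset.sum_congr rfl
    intro c _
    rw [Finset.sum_filter, sq, Finset.sum_mul_sum, Finset.mul_sum]
    apply Finset.sum_congr rfl
    intro d _
    rw [Finset.mul_sum]
  rw [h2]
  have h3 : ∀ c ∈ Finset.Icc 1 D, (c.totient : ℝ) * (∑ d ∈ (Finset.Icc 1 D).filter (fun d => c ∣ d), lam D d / d) ^ 2
      = hs c / GG D ^ 2 := by
    intro c hc
    rw [y_eq hc]
    have hc1 := (mem_Icc.1 hc).1
    have hphi : (c.totient : ℝ) ≠ 0 := by
      have := Nat.totient_pos.2 hc1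
      positivity
    unfold hs
    have hmu : ((ArithmeticFunction.moebius c : ℤ) : ℝ) ^ 6 = ((ArithmeticFunction.moebius c : ℤ) : ℝ) ^ 2 := by
      rcases ArithmeticFunction.moebius_eq_or c with h | h | h <;> rw [h] <;> norm_num
    field_simp
    linear_combination hmu
  rw [Finset.sum_congr rfl h3, ← Finset.sum_div]
  change GG D / GG D ^ 2 = _
  field_simp

lemma sum_inv_sq_le {D : ℕ} (hD : 1 ≤ D) : ∑ b ∈ Finset.Icc 1 D, (1:ℝ) / (b:ℝ) ^ 2 ≤ 2 - 1 / D := by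
  induction D, hD using Nat.le_induction with
  | base => norm_num
  | succ n hn ih =>
    rw [Finset.sum_Icc_succ_top (by omega)]
    have hn0 : (0:ℝ) < n := by exact_mod_cast hn
    have : (1:ℝ) / ((n + 1 : ℕ) : ℝ) ^ 2 ≤ 1 / (n:ℝ) - 1 / ((n + 1 : ℕ) : ℝ) := by
      push_cast
      rw [div_sub_div _ _ hn0.ne' (by positivity), div_le_div_iff₀ (by positivity) (by positivity)]
      nlinarith
    linarith

lemma GG_lower {D : ℕ} (hD : 1 ≤ D) : Real.log D ≤ 2 * GG D := by
  have h1 : Real.log D ≤ ∑ n ∈ Finset.Icc 1 D, (1:ℝ) / n := by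
    have h := log_add_one_le_harmonic D
    rw [harmonic_eq_sum_Icc] at h
    push_cast at h
    simp only [one_div]
    refine le_trans (Real.log_le_log (by exact_mod_cast hD) (by linarith)) h
  have h2 : ∑ n ∈ Finset.Icc 1 D, (1:ℝ) / n ≤
      ∑ q ∈ (Finset.Icc 1 D) ×ˢ ((Finset.Icc 1 D).filter Squarefree), (1:ℝ) / ((q.1:ℝ) ^ 2) * (1 / (q.2 : ℝ)) := by
    have hch : ∀ n : ℕ, ∃ q : ℕ × ℕ, q.1 ^ 2 * q.2 = n ∧ Squarefree q.2 := by
      intro n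
      obtain ⟨a, b, h, h'⟩ := Nat.sq_mul_squarefree n
      exact ⟨(b, a), h, h'⟩
    choose q hq1 hq2 using hch
    have hinj : ∀ n m, q n = q m → n = m := by
      intro n m h
      rw [← hq1 n, ← hq1 m, h]
    calc ∑ n ∈ Finset.Icc 1 D, (1:ℝ) / n
        = ∑ n ∈ Finset.Icc 1 D, (1:ℝ) / (((q n).1:ℝ) ^ 2) * (1 / ((q n).2 : ℝ)) := by
          apply Finset.sum_congr rfl
          intro n _
          conv_lhs => rw [← hq1 n]
          push_cast
          rw [one_div_mul_one_div]
      _ = ∑ z ∈ (Finset.Icc 1 D).image q, (1:ℝ) / ((z.1:ℝ) ^ 2) * (1 / (z.2 : ℝ)) := by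
          rw [Finset.sum_image]
          intro n _ m _ h
          exact hinj n m h
      _ ≤ _ := by
          apply Finset.sum_le_sum_of_subset_of_nonneg
          · intro z hz
            rw [mem_image] at hz
            obtain ⟨n, hn, rfl⟩ := hz
            rw [mem_Icc] at hn
            have e := hq1 n
            have hpos : 0 < (q n).1 ^ 2 * (q n).2 := by omega
            have p1 : 0 < (q n).1 := Nat.pos_of_ne_zero (by intro h; rw [h] at hpos; simp at hpos)
            have p2 : 0 < (q n).2 := Nat.pos_of_ne_zero (by intro h; rw [h] at hpos; simp at hpos)
            rw [mem_product, mem_filter, mem_Icc, mem_Icc]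
            refine ⟨⟨p1, ?_⟩, ⟨p2, ?_⟩, hq2 n⟩
            · have : (q n).1 ∣ n := ⟨(q n).1 * (q n).2, by rw [← mul_assoc, ← sq]; exact e.symm⟩
              exact (Nat.le_of_dvd hn.1 this).trans hn.2
            · have : (q n).2 ∣ n := ⟨(q n).1 ^ 2, by rw [mul_comm]; exact e.symm⟩
              exact (Nat.le_of_dvd hn.1 this).trans hn.2
          · intro z _ _; positivity
  have h3 : ∑ q ∈ (Finset.Icc 1 D) ×ˢ ((Finset.Icc 1 D).filter Squarefree), (1:ℝ) / ((q.1:ℝ) ^ 2) * (1 / (q.2 : ℝ))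
      = (∑ b ∈ Finset.Icc 1 D, (1:ℝ) / (b:ℝ) ^ 2) * ∑ s ∈ (Finset.Icc 1 D).filter Squarefree, (1:ℝ) / s := by
    rw [Finset.sum_product, Finset.sum_mul_sum]
  have h4 : ∑ s ∈ (Finset.Icc 1 D).filter Squarefree, (1:ℝ) / s ≤ GG D := by
    unfold GG
    rw [Finset.sum_filter]
    apply Finset.sum_le_sum
    intro k hk
    have hk1 := (mem_Icc.1 hk).1
    split_ifs with h
    · unfold hs
      have e1 : ((ArithmeticFunction.moebius k : ℤ) : ℝ) ^ 2 = 1 := by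
        exact_mod_cast (ArithmeticFunction.moebius_sq_eq_one_of_squarefree h)
      rw [e1]
      apply one_div_le_one_div_of_le
      · exact_mod_cast Nat.totient_pos.2 hk1
      · exact_mod_cast Nat.totient_le k
    · exact hs_nonneg k
  have h5 := sum_inv_sq_le hD
  have h6 : 0 ≤ ∑ s ∈ (Finset.Icc 1 D).filter Squarefree, (1:ℝ) / s := Finset.sum_nonneg fun s _ => by positivity
  have h7 : (0:ℝ) ≤ 1 / D := by positivity
  calc Real.log D ≤ _ := h1
    _ ≤ _ := h2
    _ = _ := h3
    _ ≤ 2 * ∑ s ∈ (Finset.Icc 1 D).filter Squarefree, (1:ℝ) / s := mul_le_mul_of_nonneg_right (by linarith) h6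
    _ ≤ _ := by linarith

def ww (D n : ℕ) : ℝ := (∑ d ∈ (Finset.Icc 1 D).filter (fun d => d ∣ n), lam D d) ^ 2

lemma ww_nonneg (D n : ℕ) : 0 ≤ ww D n := sq_nonneg _

lemma ww_prime {D p : ℕ} (hD : 1 ≤ D) (hp : p.Prime) (hpD : D < p) : ww D p = 1 := by
  unfold ww
  have : (Finset.Icc 1 D).filter (fun d => d ∣ p) = {1} := by
    ext d
    simp only [mem_filter, mem_Icc, mem_singleton]
    constructor
    · rintro ⟨⟨h1, h2⟩, h3⟩
      rcases (Nat.dvd_prime hp).1 h3 with h | h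
      · exact h
      · omega
    · rintro rfl
      exact ⟨⟨le_rfl, hD⟩, one_dvd _⟩
  rw [this, sum_singleton, lam_one hD, one_pow]

lemma sum_dvd (F : ℕ → ℤ) (hmul : ∀ m n, F (m * n) = F m * F n) {L : ℕ} (hL : 1 ≤ L) (N : ℕ) :
    ∑ n ∈ (Finset.Icc 1 N).filter (fun n => L ∣ n), F n = F L * ∑ k ∈ Finset.Icc 1 (N / L), F k := by
  rw [Finset.mul_sum]
  symm
  refine Finset.sum_nbij (fun k => L * k) ?_ ?_ ?_ ?_
  · intro k hk
    rw [mem_Icc] at hk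
    rw [mem_filter, mem_Icc]
    refine ⟨⟨Nat.mul_pos hL hk.1, ?_⟩, Dvd.intro _ rfl⟩
    rw [mul_comm]
    exact (Nat.le_div_iff_mul_le hL).1 hk.2
  · intro f _ g _ h
    exact Nat.eq_of_mul_eq_mul_left hL h
  · intro n hn
    rw [mem_coe, mem_filter, mem_Icc] at hn
    obtain ⟨⟨h1, h2⟩, k, rfl⟩ := hn
    refine ⟨k, ?_, rfl⟩
    rw [mem_coe, mem_Icc]
    refine ⟨Nat.pos_of_ne_zero (by rintro rfl; simp at h1), ?_⟩
    rw [Nat.le_div_iff_mul_le hL, mul_comm]; exact h2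
  · intro k _; exact (hmul L k).symm

lemma ww_sum (D N : ℕ) (F : ℕ → ℤ) :
    ∑ n ∈ Finset.Icc 1 N, ww D n * (F n : ℝ) = ∑ d ∈ Finset.Icc 1 D, ∑ e ∈ Finset.Icc 1 D,
      lam D d * lam D e * ((∑ n ∈ (Finset.Icc 1 N).filter (fun n => Nat.lcm d e ∣ n), F n : ℤ) : ℝ) := by
  have h1 : ∀ n ∈ Finset.Icc 1 N, ww D n * (F n : ℝ) = ∑ d ∈ Finset.Icc 1 D, ∑ e ∈ Finset.Icc 1 D,
      lam D d * lam D e * (if Nat.lcm d e ∣ n then (F n : ℝ) else 0) := by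
    intro n _
    unfold ww
    rw [Finset.sum_filter, sq, Finset.sum_mul_sum, Finset.sum_mul]
    apply Finset.sum_congr rfl
    intro d _
    rw [Finset.sum_mul]
    apply Finset.sum_congr rfl
    intro e _
    by_cases h : d ∣ n <;> by_cases h' : e ∣ n <;> simp [Nat.lcm_dvd_iff, h, h']
  rw [Finset.sum_congr rfl h1, Finset.sum_comm]
  apply Finset.sum_congr rfl
  intro d _
  rw [Finset.sum_comm]
  apply Finset.sum_congr rfl
  intro e _
  rw [← Finset.mul_sum]
  push_cast
  rw [Finset.sum_filter]

lemma lam_sum_abs {D : ℕ} (hD : 1 ≤ D) :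
    ∑ d ∈ Finset.Icc 1 D, ∑ e ∈ Finset.Icc 1 D, |lam D d * lam D e| ≤ (D:ℝ) ^ 4 := by
  calc _ ≤ ∑ d ∈ Finset.Icc 1 D, ∑ e ∈ Finset.Icc 1 D, (D:ℝ) * D := by
        apply Finset.sum_le_sum
        intro d hd
        apply Finset.sum_le_sum
        intro e he
        rw [abs_mul]
        have h1 : (d : ℝ) ≤ D := by exact_mod_cast (mem_Icc.1 hd).2
        have h2 : (e : ℝ) ≤ D := by exact_mod_cast (mem_Icc.1 he).2
        exact mul_le_mul ((lam_abs hD d).trans h1) ((lam_abs hD e).trans h2) (abs_nonneg _) (by positivity)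
    _ = _ := by simp; ring

lemma ww_sum_one {D : ℕ} (hD : 1 ≤ D) (N : ℕ) :
    ∑ n ∈ Finset.Icc 1 N, ww D n ≤ N / GG D + (D:ℝ) ^ 4 := by
  have h := ww_sum D N (fun _ => 1)
  simp only [Int.cast_one, mul_one] at h
  rw [h]
  have hL : ∀ d ∈ Finset.Icc 1 D, ∀ e ∈ Finset.Icc 1 D, 1 ≤ Nat.lcm d e := by
    intro d hd e he
    exact Nat.lcm_pos (mem_Icc.1 hd).1 (mem_Icc.1 he).1
  have h2 : N / GG D = ∑ d ∈ Finset.Icc 1 D, ∑ e ∈ Finset.Icc 1 D, lam D d * lam D e * (N / (Nat.lcm d e : ℝ)) := by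
    rw [div_eq_mul_one_div, ← lam_quad hD, Finset.mul_sum]
    apply Finset.sum_congr rfl; intro d _
    rw [Finset.mul_sum]
    apply Finset.sum_congr rfl; intro e _
    ring
  rw [h2]
  refine le_trans ?_ (add_le_add_right (lam_sum_abs hD) _)
  rw [← Finset.sum_add_distrib]
  apply Finset.sum_le_sum; intro d hd
  rw [← Finset.sum_add_distrib]
  apply Finset.sum_le_sum; intro e he
  have h3 := sum_dvd (fun _ => 1) (by simp) (hL d hd e he) N
  rw [h3]
  simp only [sum_const, Nat.card_Icc, Nat.add_sub_cancel, nsmul_eq_mul, mul_one, one_mul]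
  have hl1 : (0:ℝ) < (Nat.lcm d e : ℝ) := by exact_mod_cast hL d hd e he
  have b1 : (((N / Nat.lcm d e : ℕ) : ℤ) : ℝ) ≤ N / (Nat.lcm d e : ℝ) := by
    push_cast; exact Nat.cast_div_le
  have b2 : N / (Nat.lcm d e : ℝ) ≤ (((N / Nat.lcm d e : ℕ) : ℤ) : ℝ) + 1 := by
    rw [div_le_iff₀ hl1]
    have := Nat.lt_div_mul_add (a := N) (hL d hd e he)
    have h4 : N ≤ (N / Nat.lcm d e + 1) * Nat.lcm d e := by rw [add_mul, one_mul]; omega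
    exact_mod_cast h4
  have h5 : |(((N / Nat.lcm d e : ℕ) : ℤ) : ℝ) - N / (Nat.lcm d e : ℝ)| ≤ 1 := by
    rw [abs_le]; constructor <;> linarith
  have h6 := le_abs_self (lam D d * lam D e * ((((N / Nat.lcm d e : ℕ) : ℤ) : ℝ) - N / (Nat.lcm d e : ℝ)))
  rw [abs_mul (lam D d * lam D e)] at h6
  have h7 := mul_le_mul_of_nonneg_left h5 (abs_nonneg (lam D d * lam D e))
  rw [mul_sub] at h6
  linarith

lemma ww_sum_Jo {D : ℕ} (hD : 1 ≤ D) (N : ℕ) {t : ℕ} (ht : 1 ≤ t) (hsq : ¬ IsSquare t) :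
    ∑ n ∈ Finset.Icc 1 N, ww D n * (Jo t n : ℝ) ≤ 4 * t * (D:ℝ) ^ 4 := by
  rw [ww_sum]
  refine le_trans ?_ (mul_le_mul_of_nonneg_left (lam_sum_abs hD) (by positivity))
  rw [Finset.mul_sum]
  apply Finset.sum_le_sum; intro d hd
  rw [Finset.mul_sum]
  apply Finset.sum_le_sum; intro e he
  have hL : 1 ≤ Nat.lcm d e := Nat.lcm_pos (mem_Icc.1 hd).1 (mem_Icc.1 he).1
  rw [sum_dvd (Jo t) (Jo_mul t) hL N]
  refine (le_abs_self _).trans ?_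
  rw [abs_mul, mul_comm]
  apply mul_le_mul_of_nonneg_right _ (abs_nonneg _)
  rw [← Int.cast_abs, abs_mul]
  have h1 := Jo_sum_le ht hsq (N / Nat.lcm d e)
  have h2 := Jo_abs t (Nat.lcm d e)
  have h3 : |Jo t (Nat.lcm d e)| * |∑ k ∈ Finset.Icc 1 (N / Nat.lcm d e), Jo t k| ≤ 1 * (4 * t) :=
    mul_le_mul h2 h1 (abs_nonneg _) (by norm_num)
  rw [one_mul] at h3
  exact_mod_cast h3

end FPT

namespace FPT

lemma sq_rk_sum : ∃ C : ℝ, 1 ≤ C ∧ ∀ m : ℕ, 1 ≤ m →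
    ∑ t ∈ (Finset.Icc 1 (m ^ 4)).filter IsSquare, (rk m 4 t : ℝ) ≤ (m:ℝ) ^ 2 * (C * √m) := by
  obtain ⟨C, hC1, hC⟩ := divisor_bound 32
  have hC1' : (1:ℝ) ≤ C := by exact_mod_cast hC1
  refine ⟨C, hC1', ?_⟩
  intro m hm
  have h1 : ∀ t ∈ (Finset.Icc 1 (m ^ 4)).filter IsSquare, (rk m 4 t : ℝ) ≤ C * √m := by
    intro t ht
    have ht' := mem_Icc.1 (mem_filter.1 ht).1
    have e1 : (rk m 4 t) ^ 8 ≤ C * m ^ 4 := by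
      calc (rk m 4 t) ^ 8 ≤ (t.divisors.card ^ 4) ^ 8 := Nat.pow_le_pow_left (rk_le m 4 t ht'.1) 8
        _ = t.divisors.card ^ 32 := by rw [← pow_mul]
        _ ≤ C * t := hC t ht'.1
        _ ≤ C * m ^ 4 := Nat.mul_le_mul_left _ ht'.2
    have e2 : ((rk m 4 t : ℕ) : ℝ) ^ 8 ≤ C * (m:ℝ) ^ 4 := by exact_mod_cast e1
    refine le_of_pow_le_pow_left₀ (n := 8) (by norm_num) (by positivity) (e2.trans ?_)
    have e3 : (√(m:ℝ)) ^ 8 = (m:ℝ) ^ 4 := by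
      rw [show 8 = 2 * 4 by norm_num, pow_mul, Real.sq_sqrt (by positivity)]
    rw [mul_pow, e3]
    apply mul_le_mul_of_nonneg_right _ (by positivity)
    exact le_self_pow₀ hC1' (by norm_num)
  have h2 : ((Finset.Icc 1 (m ^ 4)).filter IsSquare).card ≤ m ^ 2 := by
    calc _ ≤ ((Finset.Icc 1 (m ^ 2)).image (fun s => s * s)).card := by
          apply Finset.card_le_card
          intro t ht
          rw [mem_filter, mem_Icc] at ht
          obtain ⟨⟨h1, h2⟩, s, rfl⟩ := ht
          rw [mem_image]
          refine ⟨s, ?_, rfl⟩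
          rw [mem_Icc]
          refine ⟨Nat.pos_of_ne_zero (by rintro rfl; simp at h1), ?_⟩
          have : s * s ≤ m ^ 2 * m ^ 2 := by rw [← pow_add]; exact h2
          exact Nat.mul_self_le_mul_self_iff.1 this
      _ ≤ (Finset.Icc 1 (m ^ 2)).card := Finset.card_image_le
      _ = _ := by simp
  calc _ ≤ (((Finset.Icc 1 (m ^ 4)).filter IsSquare).card : ℝ) * (C * √m) := by
        rw [← nsmul_eq_mul]
        exact Finset.sum_le_card_nsmul _ _ _ h1
    _ ≤ _ := by
        apply mul_le_mul_of_nonneg_right _ (by positivity)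
        exact_mod_cast h2

def So (m n : ℕ) : ℤ := if Odd n then (S m n) ^ 4 else 0

lemma So_nonneg (m n : ℕ) : 0 ≤ So m n := by
  unfold So; split_ifs
  · positivity
  · exact le_rfl

lemma So_eq (m n : ℕ) : So m n = ∑ t ∈ Finset.Icc 1 (m ^ 4), (rk m 4 t : ℤ) * Jo t n := by
  unfold So Jo
  split_ifs
  · exact S_pow m 4 n
  · simp

lemma So_sum {D : ℕ} (hD : 1 ≤ D) (m N : ℕ) :
    ∑ n ∈ Finset.Icc 1 N, ww D n * (So m n : ℝ) ≤
      (∑ t ∈ (Finset.Icc 1 (m ^ 4)).filter IsSquare, (rk m 4 t : ℝ)) * (N / GG D + (D:ℝ) ^ 4)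
        + 4 * (m:ℝ) ^ 8 * (D:ℝ) ^ 4 := by
  have h1 : ∑ n ∈ Finset.Icc 1 N, ww D n * (So m n : ℝ) =
      ∑ t ∈ Finset.Icc 1 (m ^ 4), (rk m 4 t : ℝ) * ∑ n ∈ Finset.Icc 1 N, ww D n * (Jo t n : ℝ) := by
    simp only [Finset.mul_sum]
    rw [Finset.sum_comm]
    apply Finset.sum_congr rfl
    intro n _
    rw [So_eq]
    push_cast
    rw [Finset.mul_sum]
    apply Finset.sum_congr rfl
    intro t _
    ring
  rw [h1, ← Finset.sum_filter_add_sum_filter_not (Finset.Icc 1 (m ^ 4)) IsSquare]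
  apply add_le_add
  · rw [Finset.sum_mul]
    apply Finset.sum_le_sum
    intro t _
    apply mul_le_mul_of_nonneg_left _ (by positivity)
    refine le_trans ?_ (ww_sum_one hD N)
    apply Finset.sum_le_sum
    intro n _
    have : (Jo t n : ℝ) ≤ 1 := by exact_mod_cast (le_abs_self _).trans (Jo_abs t n)
    have h := mul_le_mul_of_nonneg_left this (ww_nonneg D n)
    linarith
  · calc _ ≤ ∑ t ∈ (Finset.Icc 1 (m ^ 4)).filter (fun t => ¬ IsSquare t), (rk m 4 t : ℝ) * (4 * (m:ℝ) ^ 4 * (D:ℝ) ^ 4) := by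
          apply Finset.sum_le_sum
          intro t ht
          rw [mem_filter, mem_Icc] at ht
          apply mul_le_mul_of_nonneg_left _ (by positivity)
          refine (ww_sum_Jo hD N ht.1.1 ht.2).trans ?_
          have : (t:ℝ) ≤ (m:ℝ) ^ 4 := by exact_mod_cast ht.1.2
          gcongr
      _ ≤ ∑ t ∈ (Finset.Icc 1 (m ^ 4)), (rk m 4 t : ℝ) * (4 * (m:ℝ) ^ 4 * (D:ℝ) ^ 4) := by
          apply Finset.sum_le_sum_of_subset_of_nonneg (Finset.filter_subset _ _)
          intro t _ _; positivity
      _ = (m:ℝ) ^ 4 * (4 * (m:ℝ) ^ 4 * (D:ℝ) ^ 4) := by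
          rw [← Finset.sum_mul]
          congr 1
          exact_mod_cast rk_sum m 4
      _ = _ := by ring

def PP (ε : ℝ) (m : ℕ) (x : ℝ) : Finset ℕ := (oddPrimesUpTo x).filter (fun p => m < fpt ε p)

lemma mem_PP {ε : ℝ} {m : ℕ} {x : ℝ} {p : ℕ} (h : p ∈ PP ε m x) :
    p.Prime ∧ p ≠ 2 ∧ p ≤ ⌊x⌋₊ ∧ m < fpt ε p := by
  simp only [PP, oddPrimesUpTo, mem_filter, mem_range] at h
  exact ⟨h.1.2.1, h.1.2.2, by omega, h.2⟩

lemma moment4 {ε : ℝ} (hε : 0 < ε) {D m : ℕ} (hD : 1 ≤ D) (hm : 1 ≤ m) (x : ℝ) :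
    ((PP ε m x).card : ℝ) * (ε * m) ^ 4 ≤ D * (ε * m) ^ 4 +
      ((∑ t ∈ (Finset.Icc 1 (m ^ 4)).filter IsSquare, (rk m 4 t : ℝ)) * (⌊x⌋₊ / GG D + (D:ℝ) ^ 4)
        + 4 * (m:ℝ) ^ 8 * (D:ℝ) ^ 4) := by
  have e1 : (PP ε m x).card = ((PP ε m x).filter (fun p => p ≤ D)).card +
      ((PP ε m x).filter (fun p => ¬ p ≤ D)).card :=
    (Finset.card_filter_add_card_filter_not _).symm
  have e2 : ((PP ε m x).filter (fun p => p ≤ D)).card ≤ D := by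
    calc _ ≤ (Finset.Icc 1 D).card := by
          apply Finset.card_le_card
          intro p hp
          rw [mem_filter] at hp
          exact mem_Icc.2 ⟨(mem_PP hp.1).1.one_lt.le, hp.2⟩
      _ = D := by simp
  have e3 : (((PP ε m x).filter (fun p => ¬ p ≤ D)).card : ℝ) * (ε * m) ^ 4 ≤
      ∑ n ∈ Finset.Icc 1 ⌊x⌋₊, ww D n * (So m n : ℝ) := by
    rw [← nsmul_eq_mul]
    calc _ ≤ ∑ n ∈ (PP ε m x).filter (fun p => ¬ p ≤ D), ww D n * (So m n : ℝ) := by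
          apply Finset.card_nsmul_le_sum
          intro p hp
          rw [mem_filter] at hp
          obtain ⟨h1, h2, h3, h4⟩ := mem_PP hp.1
          rw [ww_prime hD h1 (by omega), one_mul]
          unfold So
          simp only [h1.odd_of_ne_two h2, if_true]
          push_cast
          have := (lt_fpt_iff hε h1 h2 m).1 h4 m (mem_Icc.2 ⟨hm, le_rfl⟩)
          exact pow_le_pow_left₀ (by positivity) this 4
      _ ≤ _ := by
          apply Finset.sum_le_sum_of_subset_of_nonneg
          · intro p hp
            obtain ⟨h1, h2, h3, h4⟩ := mem_PP (mem_filter.1 hp).1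
            exact mem_Icc.2 ⟨h1.one_lt.le, h3⟩
          · intro n _ _
            have : (0:ℝ) ≤ (So m n : ℝ) := by exact_mod_cast So_nonneg m n
            exact mul_nonneg (ww_nonneg D n) this
  rw [e1]
  push_cast
  rw [add_mul]
  apply add_le_add
  · apply mul_le_mul_of_nonneg_right _ (by positivity)
    exact_mod_cast e2
  · exact e3.trans (So_sum hD m ⌊x⌋₊)

end FPT

namespace FPT

lemma corr_sum {p : ℕ} [Fact p.Prime] (hp2 : p ≠ 2) {a b : ZMod p} (hab : a ≠ b) :
    ∑ j : ZMod p, quadraticChar (ZMod p) (a + j) * quadraticChar (ZMod p) (b + j) = -1 := by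
  have hring : ringChar (ZMod p) ≠ 2 := by rwa [ZMod.ringChar_zmod_n]
  have h1 := jacobiSum_nontrivial_inv (quadraticChar_ne_one hring)
  rw [(quadraticChar_isQuadratic (ZMod p)).inv] at h1
  have hc : a - b ≠ 0 := sub_ne_zero.2 hab
  have hbij : Function.Bijective (fun y : ZMod p => -a + (a - b) * y) :=
    (Equiv.addLeft (-a)).bijective.comp (mulLeft_bijective₀ _ hc)
  rw [← hbij.sum_comp]
  have h2 : ∀ y : ZMod p, quadraticChar (ZMod p) (a + (-a + (a - b) * y)) * quadraticChar (ZMod p) (b + (-a + (a - b) * y))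
      = quadraticChar (ZMod p) (-1) * (quadraticChar (ZMod p) y * quadraticChar (ZMod p) (1 - y)) := by
    intro y
    rw [show a + (-a + (a - b) * y) = (a - b) * y by ring,
      show b + (-a + (a - b) * y) = (-1) * ((a - b) * (1 - y)) by ring]
    simp only [map_mul]
    have := quadraticChar_sq_one hc
    linear_combination (quadraticChar (ZMod p) (-1) * (quadraticChar (ZMod p) y * quadraticChar (ZMod p) (1 - y))) * this
  rw [Finset.sum_congr rfl fun y _ => h2 y, ← Finset.mul_sum]
  change _ * jacobiSum _ _ = _
  rw [h1]
  have := quadraticChar_sq_one (F := ZMod p) (a := -1) (by simp)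
  linear_combination -this

lemma jac_quad {p : ℕ} [Fact p.Prime] (n : ℕ) : jacobiSym (n : ℤ) p = quadraticChar (ZMod p) (n : ZMod p) := by
  rw [← jacobiSym.legendreSym.to_jacobiSym, legendreSym]
  simp

lemma block {p : ℕ} (hp : p.Prime) (hp2 : p ≠ 2) {L : ℕ} (hL : L ≤ p) :
    (∑ j ∈ range L, ∑ i ∈ Finset.Icc 1 L, jacobiSym ((i + j : ℕ) : ℤ) p) ^ 2 ≤ (L:ℤ) ^ 2 * p := by
  have := Fact.mk hp
  have : NeZero p := ⟨hp.ne_zero⟩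
  have h1 := sq_sum_le_card_mul_sum_sq (s := range L) (f := fun j => ∑ i ∈ Finset.Icc 1 L, jacobiSym ((i + j : ℕ) : ℤ) p)
  rw [card_range] at h1
  refine h1.trans ?_
  have h2 : ∑ j ∈ range L, (∑ i ∈ Finset.Icc 1 L, jacobiSym ((i + j : ℕ) : ℤ) p) ^ 2
      ≤ ∑ j ∈ range p, (∑ i ∈ Finset.Icc 1 L, jacobiSym ((i + j : ℕ) : ℤ) p) ^ 2 := by
    apply Finset.sum_le_sum_of_subset_of_nonneg
    · exact range_subset_range.2 hL
    · intro j _ _; positivity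
  have h3 : ∑ j ∈ range p, (∑ i ∈ Finset.Icc 1 L, jacobiSym ((i + j : ℕ) : ℤ) p) ^ 2
      = ∑ i ∈ Finset.Icc 1 L, ∑ k ∈ Finset.Icc 1 L, ∑ a : ZMod p,
        quadraticChar (ZMod p) ((i : ZMod p) + a) * quadraticChar (ZMod p) ((k : ZMod p) + a) := by
    rw [sum_range_zmod]
    have e : ∀ a : ZMod p, (∑ i ∈ Finset.Icc 1 L, jacobiSym ((i + a.val : ℕ) : ℤ) p) ^ 2
       = ∑ i ∈ Finset.Icc 1 L, ∑ k ∈ Finset.Icc 1 L,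
        quadraticChar (ZMod p) ((i : ZMod p) + a) * quadraticChar (ZMod p) ((k : ZMod p) + a) := by
      intro a
      rw [sq, Finset.sum_mul_sum]
      apply Finset.sum_congr rfl; intro i _
      apply Finset.sum_congr rfl; intro k _
      rw [jac_quad, jac_quad]
      push_cast
      rw [ZMod.natCast_zmod_val]
    rw [Finset.sum_congr rfl fun a _ => e a, Finset.sum_comm]
    apply Finset.sum_congr rfl; intro i _
    rw [Finset.sum_comm]
  have h4 : ∑ i ∈ Finset.Icc 1 L, ∑ k ∈ Finset.Icc 1 L, ∑ a : ZMod p,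
        quadraticChar (ZMod p) ((i : ZMod p) + a) * quadraticChar (ZMod p) ((k : ZMod p) + a) ≤ L * p := by
    calc _ ≤ ∑ i ∈ Finset.Icc 1 L, ∑ k ∈ Finset.Icc 1 L, (if i = k then (p:ℤ) else 0) := by
          apply Finset.sum_le_sum; intro i hi
          apply Finset.sum_le_sum; intro k hk
          rw [mem_Icc] at hi hk
          split_ifs with h
          · calc _ ≤ ∑ a : ZMod p, (1:ℤ) := by
                  apply Finset.sum_le_sum; intro a _
                  rw [h, ← sq]
                  by_cases h0 : (k : ZMod p) + a = 0
                  · rw [h0]; simp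
                  · rw [quadraticChar_sq_one h0]
              _ = p := by simp [ZMod.card]
          · rw [corr_sum hp2]
            · norm_num
            · intro h'
              rw [ZMod.natCast_eq_natCast_iff] at h'
              rcases Nat.lt_or_gt_of_ne h with hlt | hlt
              · have := (Nat.modEq_iff_dvd' hlt.le).1 h'
                have := Nat.le_of_dvd (by omega) this
                omega
              · have := (Nat.modEq_iff_dvd' hlt.le).1 h'.symm
                have := Nat.le_of_dvd (by omega) this
                omega
      _ = ∑ i ∈ Finset.Icc 1 L, (p:ℤ) := by
          apply Finset.sum_congr rfl; intro i hi
          rw [Finset.sum_ite_eq]; simp only [hi, if_true]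
      _ = _ := by simp
  calc _ ≤ (L:ℤ) * (L * p) := by
        apply mul_le_mul_of_nonneg_left _ (by positivity)
        rw [h3] at h2
        exact h2.trans h4
    _ = _ := by ring

lemma S_diff (L j p : ℕ) : S (L + j) p - S j p = ∑ i ∈ Finset.Icc 1 L, jacobiSym ((i + j : ℕ) : ℤ) p := by
  induction L with
  | zero => simp
  | succ n ih =>
    rw [Finset.sum_Icc_succ_top (by omega), ← ih]
    have : S (n + 1 + j) p = S (n + j) p + jacobiSym ((n + 1 + j : ℕ) : ℤ) p := by
      unfold S
      rw [show n + 1 + j = (n + j) + 1 by ring, Finset.sum_Icc_succ_top (by omega)]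
    rw [this]; ring

def TT (L p : ℕ) : ℤ := ∑ j ∈ range L, S j p

lemma TT_double {p : ℕ} (hp : p.Prime) (hp2 : p ≠ 2) {L : ℕ} (hL : L ≤ p) :
    (TT (2 * L) p : ℝ) ≤ 2 * TT L p + L * √p := by
  have h1 : TT (2 * L) p - 2 * TT L p = ∑ j ∈ range L, ∑ i ∈ Finset.Icc 1 L, jacobiSym ((i + j : ℕ) : ℤ) p := by
    unfold TT
    rw [two_mul L, Finset.sum_range_add, two_mul, ← Finset.sum_congr rfl fun j _ => S_diff L j p, Finset.sum_sub_distrib]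
    ring
  have h2 := block hp hp2 hL
  rw [← h1] at h2
  have h3 : ((TT (2 * L) p : ℝ) - 2 * TT L p) ^ 2 ≤ (L * √p) ^ 2 := by
    rw [mul_pow, Real.sq_sqrt (by positivity)]
    exact_mod_cast h2
  have := abs_le_of_sq_le_sq h3 (by positivity)
  linarith [(abs_le.1 this).2]

lemma TT_pow {p : ℕ} (hp : p.Prime) (hp2 : p ≠ 2) (k : ℕ) (hk : 2 ^ k ≤ p) :
    2 * (TT (2 ^ k) p : ℝ) ≤ k * 2 ^ k * √p := by
  induction k with
  | zero => simp [TT, S]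
  | succ n ih =>
    have hle : 2 ^ n ≤ p := le_trans (Nat.pow_le_pow_right (by norm_num) (by omega)) hk
    have h1 := ih hle
    have h2 := TT_double hp hp2 hle
    push_cast at h2 ⊢
    rw [show 2 ^ (n + 1) = 2 * 2 ^ n by ring, show (2:ℝ) ^ (n + 1) = 2 * 2 ^ n by ring]
    nlinarith

lemma TT_lower {ε : ℝ} {p M : ℕ} (h : ∀ l ∈ Finset.Icc 1 M, ε * l ≤ S l p) (L : ℕ) (hL : L ≤ M + 1) :
    ε * L * (L - 1) ≤ 2 * (TT L p : ℝ) := by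
  induction L with
  | zero => simp [TT]
  | succ n ih =>
    have h1 := ih (by omega)
    have h2 : TT (n + 1) p = TT n p + S n p := by unfold TT; rw [Finset.sum_range_succ]
    have h3 : ε * n ≤ S n p := by
      rcases Nat.eq_zero_or_pos n with h0 | h0
      · subst h0; simp [S]
      · exact h n (mem_Icc.2 ⟨h0, by omega⟩)
    rw [h2]
    push_cast
    nlinarith

lemma vanish {ε : ℝ} (hε : 0 < ε) : ∃ C : ℝ, 0 < C ∧ ∀ D : ℕ, 1 ≤ D → ∀ x : ℝ, ⌊x⌋₊ ≤ (2 * D) ^ 20 → ∀ m : ℕ, 1 ≤ m →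
    ∀ p ∈ PP ε m x, (m:ℝ) ≤ C * (D:ℝ) ^ 11 := by
  refine ⟨2 + 81920 / ε, by positivity, ?_⟩
  intro D hD x hx m hm p hpP
  obtain ⟨hp, hp2, hpx, hf⟩ := mem_PP hpP
  set k := Nat.log 2 m with hk
  have hk1 : 2 ^ k ≤ m := Nat.pow_log_le_self 2 (by omega)
  have hk2 : m < 2 ^ (k + 1) := Nat.lt_pow_succ_log_self (by norm_num) m
  have hmp : m ≤ p := (hf.trans_le (fpt_le hε hp hp2)).le
  have h1 := TT_pow hp hp2 k (hk1.trans hmp)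
  have h2 := TT_lower ((lt_fpt_iff hε hp hp2 m).1 hf) (2 ^ k) (by omega)
  push_cast at h2
  have h3 : ε * (2 ^ k - 1) ≤ k * √p := by
    have : (2:ℝ) ^ k * (ε * (2 ^ k - 1)) ≤ 2 ^ k * (k * √p) := by nlinarith
    exact le_of_mul_le_mul_left this (by positivity)
  have hkD : k ≤ 40 * D := by
    have : 2 ^ k ≤ 2 ^ (40 * D) := by
      calc 2 ^ k ≤ p := hk1.trans hmp
        _ ≤ (2 * D) ^ 20 := hpx.trans hx
        _ ≤ (2 ^ (2 * D)) ^ 20 := Nat.pow_le_pow_left (Nat.lt_two_pow_self (n := 2 * D)).le 20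
        _ = 2 ^ (40 * D) := by rw [← pow_mul]; congr 1; ring
    exact (Nat.pow_le_pow_iff_right (by norm_num)).1 this
  have hsp : √(p:ℝ) ≤ (2 * (D:ℝ)) ^ 10 := by
    rw [Real.sqrt_le_left (by positivity), ← pow_mul]
    exact_mod_cast hpx.trans hx
  have hkD' : (k:ℝ) ≤ 40 * D := by exact_mod_cast hkD
  have h4 : ε * (2 ^ k - 1) ≤ (40 * D) * (2 * (D:ℝ)) ^ 10 :=
    h3.trans (mul_le_mul hkD' hsp (by positivity) (by positivity))
  have h5 : (2:ℝ) ^ k ≤ 1 + 40960 / ε * (D:ℝ) ^ 11 := by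
    have : (2:ℝ) ^ k - 1 ≤ ((40 * D) * (2 * (D:ℝ)) ^ 10) / ε := by
      rw [le_div_iff₀ hε]; linarith
    have e : ((40 * D) * (2 * (D:ℝ)) ^ 10) / ε = 40960 / ε * (D:ℝ) ^ 11 := by
      field_simp; ring
    linarith
  have h6 : (m:ℝ) ≤ 2 * 2 ^ k := by
    have : m ≤ 2 * 2 ^ k := by rw [pow_succ] at hk2; omega
    exact_mod_cast this
  have h7 : (1:ℝ) ≤ (D:ℝ) ^ 11 := one_le_pow₀ (by exact_mod_cast hD)
  have : (2 + 81920 / ε) * (D:ℝ) ^ 11 = 2 * (D:ℝ) ^ 11 + 2 * (40960 / ε * (D:ℝ) ^ 11) := by ring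
  linarith

end FPT

namespace FPT

lemma rk60 : ∃ C : ℝ, 1 ≤ C ∧ ∀ D : ℕ, 1 ≤ D → ∀ t ∈ Finset.Icc 1 (D ^ 60), (rk D 60 t : ℝ) ≤ C * D := by
  obtain ⟨C, hC1, hC⟩ := divisor_bound 3600
  have hC1' : (1:ℝ) ≤ C := by exact_mod_cast hC1
  refine ⟨C, hC1', ?_⟩
  intro D hD t ht
  rw [mem_Icc] at ht
  have e1 : (rk D 60 t) ^ 60 ≤ C * D ^ 60 := by
    calc (rk D 60 t) ^ 60 ≤ (t.divisors.card ^ 60) ^ 60 := Nat.pow_le_pow_left (rk_le D 60 t ht.1) 60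
      _ = t.divisors.card ^ 3600 := by rw [← pow_mul]
      _ ≤ C * t := hC t ht.1
      _ ≤ C * D ^ 60 := Nat.mul_le_mul_left _ ht.2
  have e2 : ((rk D 60 t : ℕ) : ℝ) ^ 60 ≤ C * (D:ℝ) ^ 60 := by exact_mod_cast e1
  refine le_of_pow_le_pow_left₀ (n := 60) (by norm_num) (by positivity) (e2.trans ?_)
  rw [mul_pow]
  apply mul_le_mul_of_nonneg_right _ (by positivity)
  exact le_self_pow₀ hC1' (by norm_num)

lemma dual_sum (A : Finset ℕ) (X N : ℕ) (hA : ∀ p ∈ A, p.Prime ∧ p ≠ 2 ∧ p ≤ X) :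
    ∑ t ∈ Finset.Icc 1 N, (∑ p ∈ A, jacobiSym (t : ℤ) p) ^ 2 ≤ (A.card : ℤ) * N + (A.card : ℤ) ^ 2 * (X : ℤ) ^ 2 := by
  have h1 : ∑ t ∈ Finset.Icc 1 N, (∑ p ∈ A, jacobiSym (t : ℤ) p) ^ 2
      = ∑ p ∈ A, ∑ q ∈ A, ∑ t ∈ Finset.Icc 1 N, jacobiSym (t : ℤ) p * jacobiSym (t : ℤ) q := by
    have e : ∀ t : ℕ, (∑ p ∈ A, jacobiSym (t : ℤ) p) ^ 2 = ∑ p ∈ A, ∑ q ∈ A, jacobiSym (t : ℤ) p * jacobiSym (t : ℤ) q := by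
      intro t; rw [sq, Finset.sum_mul_sum]
    rw [Finset.sum_congr rfl fun t _ => e t, Finset.sum_comm]
    apply Finset.sum_congr rfl; intro p _
    rw [Finset.sum_comm]
  rw [h1]
  calc _ ≤ ∑ p ∈ A, ∑ q ∈ A, ((if p = q then (N:ℤ) else 0) + (X:ℤ) ^ 2) := by
        apply Finset.sum_le_sum; intro p hp
        apply Finset.sum_le_sum; intro q hq
        split_ifs with h
        · calc _ ≤ ∑ t ∈ Finset.Icc 1 N, (1:ℤ) := by
                apply Finset.sum_le_sum; intro t _
                refine (le_abs_self _).trans ?_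
                rw [abs_mul]
                exact mul_le_one₀ (jac_abs _ _) (abs_nonneg _) (jac_abs _ _)
            _ = N := by simp
            _ ≤ _ := by have : (0:ℤ) ≤ (X:ℤ) ^ 2 := by positivity
                        linarith
        · obtain ⟨p1, p2, p3⟩ := hA p hp
          obtain ⟨q1, q2, q3⟩ := hA q hq
          have h2 := (le_abs_self _).trans (jj_sum_le p1 q1 p2 h N)
          have h3 : (p:ℤ) * q ≤ (X:ℤ) ^ 2 := by
            rw [sq]
            exact_mod_cast Nat.mul_le_mul p3 q3
          linarith
    _ = _ := by
        have e : ∀ p ∈ A, ∑ q ∈ A, ((if p = q then (N:ℤ) else 0) + (X:ℤ) ^ 2) = N + A.card * (X:ℤ) ^ 2 := by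
          intro p hp
          rw [Finset.sum_add_distrib, Finset.sum_ite_eq]; simp [hp]
        rw [Finset.sum_congr rfl e]
        simp only [sum_const, nsmul_eq_mul]
        ring

lemma sieve_raw {ε : ℝ} (hε : 0 < ε) {C : ℝ} (hC : 1 ≤ C) {D : ℕ} (hD : 1 ≤ D)
    (hr : ∀ t ∈ Finset.Icc 1 (D ^ 60), (rk D 60 t : ℝ) ≤ C * D) {x : ℝ} (hx : ⌊x⌋₊ ≤ (2 * D) ^ 20) :
    (((PP ε D x).card : ℝ) * (ε * D) ^ 60) ^ 2 ≤ ((D:ℝ) ^ 60 * (C * D) ^ 2) *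
      ((PP ε D x).card * (D:ℝ) ^ 60 + ((PP ε D x).card : ℝ) ^ 2 * ((2 * (D:ℝ)) ^ 20) ^ 2) := by
  set A := PP ε D x with hA
  have h1 : (A.card : ℝ) * (ε * D) ^ 60 ≤ ∑ t ∈ Finset.Icc 1 (D ^ 60), (rk D 60 t : ℝ) * ((∑ p ∈ A, jacobiSym (t : ℤ) p : ℤ) : ℝ) := by
    calc (A.card : ℝ) * (ε * D) ^ 60 ≤ ∑ p ∈ A, ((S D p : ℝ)) ^ 60 := by
          rw [← nsmul_eq_mul]
          apply Finset.card_nsmul_le_sum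
          intro p hp
          obtain ⟨p1, p2, p3, p4⟩ := mem_PP hp
          have := (lt_fpt_iff hε p1 p2 D).1 p4 D (mem_Icc.2 ⟨hD, le_rfl⟩)
          exact pow_le_pow_left₀ (by positivity) this 60
      _ = ∑ p ∈ A, ∑ t ∈ Finset.Icc 1 (D ^ 60), (rk D 60 t : ℝ) * (jacobiSym (t : ℤ) p : ℝ) := by
          apply Finset.sum_congr rfl; intro p _
          have := S_pow D 60 p
          exact_mod_cast this
      _ = _ := by
          rw [Finset.sum_comm]
          apply Finset.sum_congr rfl; intro t _
          push_cast
          rw [Finset.mul_sum]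
  have h2 := Finset.sum_mul_sq_le_sq_mul_sq (Finset.Icc 1 (D ^ 60)) (fun t => (rk D 60 t : ℝ)) (fun t => ((∑ p ∈ A, jacobiSym (t : ℤ) p : ℤ) : ℝ))
  have h3 := pow_le_pow_left₀ (by positivity) h1 2
  refine h3.trans (h2.trans ?_)
  have h4 : ∑ t ∈ Finset.Icc 1 (D ^ 60), (rk D 60 t : ℝ) ^ 2 ≤ (D:ℝ) ^ 60 * (C * D) ^ 2 := by
    calc _ ≤ (Finset.Icc 1 (D ^ 60)).card • (C * D) ^ 2 := by
          apply Finset.sum_le_card_nsmul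
          intro t ht
          exact pow_le_pow_left₀ (by positivity) (hr t ht) 2
      _ = _ := by rw [nsmul_eq_mul, Nat.card_Icc, Nat.add_sub_cancel]; push_cast; rfl
  have h5 := dual_sum A ⌊x⌋₊ (D ^ 60) (fun p hp => by
    obtain ⟨p1, p2, p3, p4⟩ := mem_PP hp
    exact ⟨p1, p2, p3⟩)
  have h6 : ∑ t ∈ Finset.Icc 1 (D ^ 60), (((∑ p ∈ A, jacobiSym (t : ℤ) p : ℤ) : ℝ)) ^ 2
      ≤ A.card * (D:ℝ) ^ 60 + (A.card : ℝ) ^ 2 * ((2 * (D:ℝ)) ^ 20) ^ 2 := by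
    have e1 : ∑ t ∈ Finset.Icc 1 (D ^ 60), (((∑ p ∈ A, jacobiSym (t : ℤ) p : ℤ) : ℝ)) ^ 2 ≤
        A.card * (D:ℝ) ^ 60 + (A.card : ℝ) ^ 2 * ((⌊x⌋₊ : ℕ) : ℝ) ^ 2 := by exact_mod_cast h5
    refine e1.trans ?_
    have e2 : ((⌊x⌋₊ : ℕ) : ℝ) ≤ (2 * (D:ℝ)) ^ 20 := by exact_mod_cast hx
    gcongr
  exact mul_le_mul h4 h6 (Finset.sum_nonneg fun t _ => by positivity) (by positivity)

lemma sieve {ε : ℝ} (hε : 0 < ε) : ∃ C : ℝ, 0 < C ∧ ∃ D0 : ℕ, ∀ D : ℕ, D0 ≤ D → 1 ≤ D → ∀ x : ℝ, ⌊x⌋₊ ≤ (2 * D) ^ 20 →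
    ((PP ε D x).card : ℝ) ≤ C * (D:ℝ) ^ 2 := by
  obtain ⟨C, hC, hr⟩ := rk60
  set K := ε ^ 120 with hK
  have hK0 : 0 < K := by positivity
  refine ⟨2 * C ^ 2 / K, by positivity, ⌈2 * C ^ 2 * 2 ^ 40 / K⌉₊, ?_⟩
  intro D hD0 hD x hx
  have h := sieve_raw hε hC hD (hr D hD) hx
  set R := ((PP ε D x).card : ℝ) with hR
  have hR0 : 0 ≤ R := by positivity
  have hDr : (1:ℝ) ≤ D := by exact_mod_cast hD
  rcases hR0.eq_or_lt with h0 | h0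
  · rw [← h0]; positivity
  have hDK : 2 * C ^ 2 * 2 ^ 40 ≤ K * D := by
    have := (Nat.le_ceil (2 * C ^ 2 * 2 ^ 40 / K)).trans (by exact_mod_cast hD0 : _ ≤ (D:ℝ))
    rw [div_le_iff₀ hK0] at this
    linarith
  set d := (D:ℝ) with hd
  have hdpos : 0 < d := by linarith
  have e1 : (R * (ε * d) ^ 60) ^ 2 = (R * d ^ 60) * (R * (K * d ^ 60)) := by rw [hK]; ring
  have e2 : (d ^ 60 * (C * d) ^ 2) * (R * d ^ 60 + R ^ 2 * ((2 * d) ^ 20) ^ 2)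
     = (R * d ^ 60) * (C ^ 2 * d ^ 2 * d ^ 60 + R * (C ^ 2 * 2 ^ 40) * d ^ 42) := by ring
  rw [e1, e2] at h
  have h3 := le_of_mul_le_mul_left h (by positivity)
  have h4 : R * (C ^ 2 * 2 ^ 40) * d ^ 42 ≤ R * (K * d ^ 60) / 2 := by
    have e3 : d * d ^ 42 ≤ d ^ 60 := by
      rw [← pow_succ']
      exact pow_le_pow_right₀ hDr (by norm_num)
    calc R * (C ^ 2 * 2 ^ 40) * d ^ 42 = R * ((2 * C ^ 2 * 2 ^ 40) * d ^ 42) / 2 := by ring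
      _ ≤ R * ((K * d) * d ^ 42) / 2 := by gcongr
      _ = R * (K * (d * d ^ 42)) / 2 := by ring
      _ ≤ _ := by gcongr
  have h5 : d ^ 60 * (R * K) ≤ d ^ 60 * (2 * C ^ 2 * d ^ 2) := by nlinarith
  have h6 := le_of_mul_le_mul_left h5 (by positivity)
  rw [div_mul_eq_mul_div, le_div_iff₀ hK0]
  exact h6

end FPT

namespace FPT

lemma u_eq {m : ℕ} (hm : 1 ≤ m) : (m:ℝ) ^ (-(3/2) : ℝ) = √m / (m:ℝ) ^ 2 := by
  have h : (0:ℝ) < m := by exact_mod_cast hm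
  rw [Real.sqrt_eq_rpow, ← Real.rpow_natCast, ← Real.rpow_sub h]
  norm_num

lemma small_case {ε : ℝ} (hε : 0 < ε) : ∃ C : ℝ, ∀ (D m : ℕ) (x : ℝ), 2 ≤ D → 1 ≤ m → m ≤ D → (D:ℝ) ^ 20 ≤ x →
    Real.log x ≤ 40 * Real.log D → gm ε m x ≤ C * (√m / (m:ℝ) ^ 2) := by
  obtain ⟨C, hC, hs⟩ := sq_rk_sum
  refine ⟨40 + 120 * C / ε ^ 4 + 160 / ε ^ 4, ?_⟩
  intro D m x hD hm hmD hx hlog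
  have hd : (2:ℝ) ≤ D := by exact_mod_cast hD
  have hmr : (1:ℝ) ≤ m := by exact_mod_cast hm
  have hmDr : (m:ℝ) ≤ D := by exact_mod_cast hmD
  have h := moment4 hε (show 1 ≤ D by omega) hm x
  have hs' := hs m hm
  have hG := GG_pos (show 1 ≤ D by omega)
  have hGl := GG_lower (show 1 ≤ D by omega)
  set d := (D:ℝ) with hdd
  set μ := (m:ℝ) with hμ
  set u := √μ / μ ^ 2 with hu
  set G := GG D with hGG
  have hd0 : 0 < d := by linarith
  have hμ0 : 0 < μ := by linarith
  have hx0 : 0 < x := lt_of_lt_of_le (by positivity) hx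
  have hx1 : 1 ≤ x := le_trans (one_le_pow₀ (by linarith)) hx
  have hlx : 0 ≤ Real.log x := Real.log_nonneg hx1
  have hN : ((⌊x⌋₊ : ℕ) : ℝ) ≤ x := Nat.floor_le hx0.le
  have hsm : 1 ≤ √μ := by rw [Real.one_le_sqrt]; exact hmr
  have hu0 : 0 < u := by positivity
  have hdu : 1 / d ^ 2 ≤ u := by
    rw [hu, div_le_div_iff₀ (by positivity) (by positivity)]
    have : μ ^ 2 ≤ d ^ 2 := pow_le_pow_left₀ hμ0.le hmDr 2
    have h2 : d ^ 2 ≤ √μ * d ^ 2 := le_mul_of_one_le_left (by positivity) hsm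
    linarith
  set c := ((PP ε m x).card : ℝ) with hc
  have h1 : c ≤ d + C / ε ^ 4 * u * (x / G + d ^ 4) + 4 / ε ^ 4 * d ^ 8 := by
    have e1 : c * (ε * μ) ^ 4 ≤ (d + C / ε ^ 4 * u * (x / G + d ^ 4) + 4 / ε ^ 4 * d ^ 8) * (ε * μ) ^ 4 := by
      refine h.trans ?_
      have e2 : (d + C / ε ^ 4 * u * (x / G + d ^ 4) + 4 / ε ^ 4 * d ^ 8) * (ε * μ) ^ 4
        = d * (ε * μ) ^ 4 + ((μ ^ 2 * (C * √μ)) * (x / G + d ^ 4) + 4 * μ ^ 4 * d ^ 8) := by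
        rw [hu]; field_simp; ring
      rw [e2]
      have e3 : (∑ t ∈ (Finset.Icc 1 (m ^ 4)).filter IsSquare, (rk m 4 t : ℝ)) * (((⌊x⌋₊ : ℕ) : ℝ) / G + d ^ 4)
          ≤ (μ ^ 2 * (C * √μ)) * (x / G + d ^ 4) := by
        apply mul_le_mul hs' _ (by positivity) (by positivity)
        gcongr
      have e4 : 4 * μ ^ 8 * d ^ 4 ≤ 4 * μ ^ 4 * d ^ 8 := by
        have : μ ^ 4 ≤ d ^ 4 := pow_le_pow_left₀ hμ0.le hmDr 4
        have h3 := mul_le_mul_of_nonneg_left this (show 0 ≤ 4 * μ ^ 4 * d ^ 4 by positivity)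
        nlinarith
      linarith
    exact le_of_mul_le_mul_right e1 (by positivity)
  have hlogd : Real.log d ≤ d := (Real.log_le_sub_one_of_pos hd0).trans (by linarith)
  have hlogd0 : 0 < Real.log d := Real.log_pos (by linarith)
  have hratio : Real.log x / x ≤ 40 / d ^ 19 := by
    rw [div_le_div_iff₀ hx0 (by positivity)]
    calc Real.log x * d ^ 19 ≤ (40 * d) * d ^ 19 := by gcongr; linarith
      _ = 40 * d ^ 20 := by ring
      _ ≤ 40 * x := by linarith
  have hr0 : 0 ≤ Real.log x / x := by positivity
  have hLG : Real.log x / x * (x / G) ≤ 80 := by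
    have : Real.log x / x * (x / G) = Real.log x / G := by field_simp
    rw [this, div_le_iff₀ hG]
    linarith
  have hp : ∀ k : ℕ, k ≤ 17 → 40 / d ^ 19 * d ^ k ≤ 40 * (1 / d ^ 2) := by
    intro k hk
    have e : d ^ k ≤ d ^ 17 := pow_le_pow_right₀ (by linarith) hk
    calc 40 / d ^ 19 * d ^ k ≤ 40 / d ^ 19 * d ^ 17 := by gcongr
      _ = _ := by field_simp
  have hd2 : 1 / d ^ 2 ≤ 1 := by
    rw [div_le_one (by positivity)]; nlinarith
  change Real.log x / x * c ≤ _
  calc Real.log x / x * c ≤ Real.log x / x * (d + C / ε ^ 4 * u * (x / G + d ^ 4) + 4 / ε ^ 4 * d ^ 8) := by gcongr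
    _ = Real.log x / x * d ^ 1 + C / ε ^ 4 * u * (Real.log x / x * (x / G) + Real.log x / x * d ^ 4) + 4 / ε ^ 4 * (Real.log x / x * d ^ 8) := by ring
    _ ≤ 40 / d ^ 19 * d ^ 1 + C / ε ^ 4 * u * (80 + 40 / d ^ 19 * d ^ 4) + 4 / ε ^ 4 * (40 / d ^ 19 * d ^ 8) := by gcongr
    _ ≤ 40 * (1 / d ^ 2) + C / ε ^ 4 * u * (80 + 40 * (1 / d ^ 2)) + 4 / ε ^ 4 * (40 * (1 / d ^ 2)) := by
        have p4 := hp 4 (by norm_num)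
        exact add_le_add (add_le_add (hp 1 (by norm_num)) (mul_le_mul_of_nonneg_left (by linarith) (by positivity)))
          (mul_le_mul_of_nonneg_left (hp 8 (by norm_num)) (by positivity))
    _ ≤ 40 * u + C / ε ^ 4 * u * (80 + 40 * 1) + 4 / ε ^ 4 * (40 * u) := by gcongr
    _ = _ := by ring

lemma large_case {ε : ℝ} (hε : 0 < ε) : ∃ C : ℝ, ∃ D0 : ℕ, ∀ (D m : ℕ) (x : ℝ), D0 ≤ D → 2 ≤ D → D < m → (D:ℝ) ^ 20 ≤ x →
    ⌊x⌋₊ ≤ (2 * D) ^ 20 →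
    Real.log x ≤ 40 * Real.log D → gm ε m x ≤ C * (√m / (m:ℝ) ^ 2) := by
  obtain ⟨C1, hC1, D0, h1⟩ := sieve hε
  obtain ⟨C2', hC2', h2'⟩ := vanish hε
  obtain ⟨C2, hC2, h2⟩ : ∃ C2 : ℝ, 1 ≤ C2 ∧ ∀ D : ℕ, 1 ≤ D → ∀ x : ℝ, ⌊x⌋₊ ≤ (2 * D) ^ 20 → ∀ m : ℕ, 1 ≤ m →
    ∀ p ∈ PP ε m x, (m:ℝ) ≤ C2 * (D:ℝ) ^ 11 := by
    refine ⟨max C2' 1, le_max_right _ _, ?_⟩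
    intro D hD x hx m hm p hp
    exact (h2' D hD x hx m hm p hp).trans (mul_le_mul_of_nonneg_right (le_max_left _ _) (by positivity))
  refine ⟨40 * C1 * C2 ^ 2, D0, ?_⟩
  intro D m x hD0 hD hm hx hxf hlog
  have hd : (2:ℝ) ≤ D := by exact_mod_cast hD
  have hmr : (1:ℝ) ≤ m := by exact_mod_cast (show 1 ≤ m by omega)
  rcases (PP ε m x).eq_empty_or_nonempty with h0 | ⟨p, hp⟩
  · have : gm ε m x = 0 := by
      change Real.log x / x * ((PP ε m x).card : ℝ) = 0
      rw [h0]; simp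
    rw [this]; positivity
  have hmC := h2 D (by omega) x hxf m (by omega) p hp
  have hcard : ((PP ε m x).card : ℝ) ≤ C1 * (D:ℝ) ^ 2 := by
    refine le_trans ?_ (h1 D hD0 (by omega) x hxf)
    have : (PP ε m x).card ≤ (PP ε D x).card := by
      apply Finset.card_le_card
      intro q hq
      unfold PP at hq ⊢
      rw [mem_filter] at hq ⊢
      exact ⟨hq.1, by omega⟩
    exact_mod_cast this
  set d := (D:ℝ) with hdd
  set μ := (m:ℝ) with hμ
  have hd0 : 0 < d := by linarith
  have hμ0 : 0 < μ := by linarith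
  have hx0 : 0 < x := lt_of_lt_of_le (by positivity) hx
  have hx1 : 1 ≤ x := le_trans (one_le_pow₀ (by linarith)) hx
  have hlx : 0 ≤ Real.log x := Real.log_nonneg hx1
  have hlogd : Real.log d ≤ d := (Real.log_le_sub_one_of_pos hd0).trans (by linarith)
  have hratio : Real.log x / x ≤ 40 / d ^ 19 := by
    rw [div_le_div_iff₀ hx0 (by positivity)]
    calc Real.log x * d ^ 19 ≤ (40 * d) * d ^ 19 := by gcongr; linarith
      _ = 40 * d ^ 20 := by ring
      _ ≤ 40 * x := by linarith
  have hu : 1 / d ^ 17 ≤ C2 ^ 2 * (√μ / μ ^ 2) := by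
    refine le_of_pow_le_pow_left₀ (n := 2) (by norm_num) (by positivity) ?_
    rw [mul_pow, div_pow √μ, Real.sq_sqrt hμ0.le, div_pow, one_pow, mul_div_assoc', div_le_div_iff₀ (by positivity) (by positivity)]
    have e1 : μ ^ 3 ≤ (C2 * d ^ 11) ^ 3 := pow_le_pow_left₀ hμ0.le hmC 3
    have e2 : (C2 * d ^ 11) ^ 3 ≤ C2 ^ 4 * d ^ 34 := by
      calc (C2 * d ^ 11) ^ 3 = C2 ^ 3 * d ^ 33 := by ring
        _ ≤ C2 ^ 4 * d ^ 34 := by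
          apply mul_le_mul (pow_le_pow_right₀ hC2 (by norm_num)) (pow_le_pow_right₀ (by linarith) (by norm_num)) (by positivity) (by positivity)
    calc 1 * (μ ^ 2) ^ 2 = μ * μ ^ 3 := by ring
      _ ≤ μ * (C2 ^ 4 * d ^ 34) := mul_le_mul_of_nonneg_left (e1.trans e2) hμ0.le
      _ = _ := by ring
  change Real.log x / x * ((PP ε m x).card : ℝ) ≤ _
  calc _ ≤ 40 / d ^ 19 * (C1 * d ^ 2) := by gcongr
    _ = 40 * C1 * (1 / d ^ 17) := by field_simp
    _ ≤ 40 * C1 * (C2 ^ 2 * (√μ / μ ^ 2)) := by gcongr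
    _ = _ := by ring

lemma KB {ε : ℝ} (hε : 0 < ε) :
    ∃ C : ℝ, ∀ᶠ x in atTop, ∀ m : ℕ, 1 ≤ m → gm ε m x ≤ C * (m:ℝ)^(-(3/2) : ℝ) := by
  obtain ⟨C1, h1⟩ := small_case hε
  obtain ⟨C2, D0, h2⟩ := large_case hε
  refine ⟨max C1 C2, ?_⟩
  have ht : Tendsto (fun x : ℝ => ⌊x ^ ((1:ℝ)/20)⌋₊) atTop atTop :=
    tendsto_nat_floor_atTop.comp (tendsto_rpow_atTop (by norm_num))
  filter_upwards [ht.eventually (eventually_ge_atTop (max D0 2)), eventually_gt_atTop 0] with x hx hx0 m hm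
  set D := ⌊x ^ ((1:ℝ)/20)⌋₊ with hDdef
  have hD0 : D0 ≤ D := (le_max_left _ _).trans hx
  have hD2 : 2 ≤ D := (le_max_right _ _).trans hx
  have hd : (2:ℝ) ≤ D := by exact_mod_cast hD2
  have hy0 : 0 ≤ x ^ ((1:ℝ)/20) := by positivity
  have hxy : (x ^ ((1:ℝ)/20)) ^ 20 = x := by
    rw [← Real.rpow_natCast, ← Real.rpow_mul hx0.le]; norm_num
  have hlow : (D:ℝ) ^ 20 ≤ x := by
    calc (D:ℝ) ^ 20 ≤ (x ^ ((1:ℝ)/20)) ^ 20 := pow_le_pow_left₀ (by positivity) (Nat.floor_le hy0) 20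
      _ = x := hxy
  have hup : x ≤ (2 * (D:ℝ)) ^ 20 := by
    calc x = (x ^ ((1:ℝ)/20)) ^ 20 := hxy.symm
      _ ≤ (2 * (D:ℝ)) ^ 20 := by
        apply pow_le_pow_left₀ hy0
        have := (Nat.lt_floor_add_one (x ^ ((1:ℝ)/20))).le
        rw [← hDdef] at this
        linarith
  have hfl : ⌊x⌋₊ ≤ (2 * D) ^ 20 := by
    apply Nat.floor_le_of_le
    push_cast
    exact hup
  have hlog : Real.log x ≤ 40 * Real.log D := by
    have e1 := Real.log_le_log hx0 hup
    rw [Real.log_pow, Real.log_mul (by norm_num) (by positivity)] at e1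
    have e2 := Real.log_le_log (by norm_num) hd
    push_cast at e1
    linarith
  rw [u_eq hm]
  have hu : 0 ≤ √(m:ℝ) / (m:ℝ) ^ 2 := by positivity
  by_cases hmD : m ≤ D
  · exact (h1 D m x hD2 hm hmD hlow hlog).trans (mul_le_mul_of_nonneg_right (le_max_left _ _) hu)
  · exact (h2 D m x hD0 hD2 (by omega) hlow hfl hlog).trans (mul_le_mul_of_nonneg_right (le_max_right _ _) hu)

end FPT

/-- For every `ε > 0` there is `c_ε ∈ (0,∞)` with `∑_{p ≤ x} f_ε(p) ∼ c_ε x / log x`,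
i.e. `(log x / x) ∑_{p ≤ x} f_ε(p) → c_ε` as `x → ∞`. -/
theorem stmt0 (ε : ℝ) (hε : 0 < ε) :
    ∃ c : ℝ, 0 < c ∧
      Filter.Tendsto
        (fun x : ℝ => (Real.log x / x) * ∑ p ∈ oddPrimesUpTo x, (fpt ε p : ℝ))
        Filter.atTop (nhds c) := by
  exact FPT.final ε hε (FPT.KB hε)

end
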